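/- There exists N₃ ∈ ℕ such that for every n ≥ N₃ and every σ ∈ S_n with exactly 2 fixed points, for every irreducible complex character χ of S_n other than the trivial and sign characters, χ̃(σ) ≤ 1/(n-1). (That is, the standard representation rules for σ, since its normalized character at σ equals (c₁(σ)-1)/(n-1) = 1/(n-1).) -/

import Mathlib

open CategoryTheory

/-- `c₁(σ)`: the number of fixed points of a permutation. -/
def fixCount {n : ℕ} (σ : Equiv.Perm (Fin n)) : ℕ :=
  (Finset.univ.filter fun x => σ x = x).card

/-- `c_ℓ(σ)`: the number of `ℓ`-cycles of a permutation (for `ℓ ≥ 2`). -/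
def cyc {n : ℕ} (ℓ : ℕ) (σ : Equiv.Perm (Fin n)) : ℕ :=
  Multiset.count ℓ σ.cycleType

/-- The (real-valued) normalized character `χ̃(σ) = χ(σ)/χ(1)` of `V` at `σ`. -/
noncomputable def normChar {n : ℕ} (V : FDRep ℂ (Equiv.Perm (Fin n)))
    (σ : Equiv.Perm (Fin n)) : ℝ :=
  (V.character σ / V.character 1).re

/-- `V` is an irreducible representation whose character is neither the trivial
character nor the sign character. -/
def IsNontrivIrr {n : ℕ} (V : FDRep ℂ (Equiv.Perm (Fin n))) : Prop :=
  Simple V ∧ V.character ≠ (fun _ => 1) ∧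
    V.character ≠ (fun σ => ((Equiv.Perm.sign σ : ℤ) : ℂ))

/-- The maximum of the normalized characters `F₁(σ), …, F₈(σ)` at `σ` of the eight
irreps `EIGHT_n = {(n-1,1), (n-2,2), (n-3,3), (n-3,2,1), (n-4,4),
(n-1,1)ᵗ, (n-2,2)ᵗ, (n-2,1,1)ᵗ}`. -/
noncomputable def maxF (n : ℕ) (σ : Equiv.Perm (Fin n)) : ℝ :=
  let c1 : ℝ := fixCount σ
  let c2 : ℝ := cyc 2 σ
  let c3 : ℝ := cyc 3 σ
  let c4 : ℝ := cyc 4 σ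
  let e : ℝ := ((Equiv.Perm.sign σ : ℤ) : ℝ)
  let N : ℝ := n
  let F1 := (c1 - 1) / (N - 1)
  let F2 := (c1 * (c1 - 3) / 2 + c2) / (N * (N - 3) / 2)
  let F3 := (c1 * (c1 - 1) * (c1 - 5) / 6 + (c1 - 1) * c2 + c3) / (N * (N - 1) * (N - 5) / 6)
  let F4 := (c1 * (c1 - 2) * (c1 - 4) / 3 - c3) / (N * (N - 2) * (N - 4) / 3)
  let F5 := (c1 * (c1 - 1) * (c1 - 2) * (c1 - 7) / 24 + (c1 ^ 2 - 3 * c1 - 1) * c2 / 2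
      + c2 ^ 2 / 2 + (c1 - 1) * c3 + c4) / (N * (N - 1) * (N - 2) * (N - 7) / 24)
  let F6 := e * F1
  let F7 := e * F2
  let F8 := e * ((c1 - 1) * (c1 - 2) / 2 - c2) / ((N - 1) * (N - 2) / 2)
  max (max (max F1 F2) (max F3 F4)) (max (max F5 F6) (max F7 F8))

/-- A representation `ρ` of a finite group `G` without proper invariant subspaces, such that the
sum of `ρ` over the conjugates of `σ` is the scalar `|G| * lam σ`. -/
structure IsScalarIrr {G V : Type} [Group G] [Fintype G] [AddCommGroup V] [Module ℂ V]
    (ρ : Representation ℂ G V) (lam : G → ℂ) : Prop where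
  nontrivial : Nontrivial V
  irr : ∀ W : Submodule ℂ V, (∀ g, ∀ v ∈ W, ρ g v ∈ W) → W = ⊥ ∨ W = ⊤
  avg : ∀ σ v, ∑ g : G, ρ (g * σ * g⁻¹) v = ((Fintype.card G : ℂ) * lam σ) • v

theorem FDRep.exists_scalar_of_commute {G : Type} [Group G] (V : FDRep ℂ G) [Simple V]
    (f : V →ₗ[ℂ] V) (hf : ∀ g v, f (V.ρ g v) = V.ρ g (f v)) : ∃ c : ℂ, ∀ v, f v = c • v := by
  let F : V ⟶ V := ⟨InducedCategory.homMk (ModuleCat.ofHom f), fun g ↦ by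
    ext v
    exact hf g v⟩
  have h1 : Module.finrank ℂ (V ⟶ V) = 1 := finrank_endomorphism_simple_eq_one ℂ V
  obtain ⟨c, hc⟩ := (finrank_eq_one_iff_of_nonzero' (𝟙 V) (id_nonzero V)).mp h1 F
  refine ⟨c, fun v ↦ ?_⟩
  have := congrArg (fun φ : V ⟶ V ↦ φ.hom.hom.hom v) hc
  exact this.symm

theorem FDRep.eq_bot_or_top_of_simple {G : Type} [Group G] (V : FDRep ℂ G) [Simple V]
    (W : Submodule ℂ V) (hW : ∀ g, ∀ v ∈ W, V.ρ g v ∈ W) : W = ⊥ ∨ W = ⊤ := by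
  let S : Subrepresentation V.ρ := ⟨W, fun g v hv ↦ hW g v hv⟩
  let U : FDRep ℂ G := FDRep.of S.toRepresentation
  let F : U ⟶ V := ⟨InducedCategory.homMk (ModuleCat.ofHom W.subtype), fun g ↦ by
    ext v
    rfl⟩
  have : Mono F := by
    constructor
    intro Z a b hab
    ext x
    exact congrArg (fun φ : Z ⟶ V ↦ φ.hom.hom.hom x) hab
  by_cases h0 : F = 0
  · left
    rw [Submodule.eq_bot_iff]
    intro x hx
    exact congrArg (fun φ : U ⟶ V ↦ φ.hom.hom.hom (⟨x, hx⟩ : W)) h0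
  · right
    have : IsIso F := isIso_of_mono_of_nonzero h0
    rw [Submodule.eq_top_iff']
    intro x
    have hx := congrArg (fun φ : V ⟶ V ↦ φ.hom.hom.hom x) (IsIso.inv_hom_id F)
    have : F.hom.hom.hom ((inv F).hom.hom.hom x) = x := hx
    rw [← this]
    exact ((inv F).hom.hom.hom x : W).2

theorem FDRep.nontrivial_of_simple {G : Type} [Group G] (V : FDRep ℂ G) [Simple V] :
    Nontrivial V := by
  by_contra h
  rw [not_nontrivial_iff_subsingleton] at h
  apply id_nonzero V
  ext v
  exact Subsingleton.elim (α := V) _ _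

theorem FDRep.isScalarIrr {G : Type} [Group G] [Fintype G] (V : FDRep ℂ G) [Simple V] :
    IsScalarIrr (V := V) V.ρ (fun σ ↦ V.character σ / V.character 1) where
  nontrivial := V.nontrivial_of_simple
  irr := V.eq_bot_or_top_of_simple
  avg := by
    intro σ
    have hnt := V.nontrivial_of_simple
    obtain ⟨c, hc⟩ := V.exists_scalar_of_commute (∑ g : G, V.ρ (g * σ * g⁻¹)) (by
      intro h v
      simp only [LinearMap.sum_apply, map_sum]
      refine Fintype.sum_equiv (Equiv.mulLeft h⁻¹) _ _ fun g ↦ ?_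
      simp only [Equiv.coe_mulLeft, ← Module.End.mul_apply, ← map_mul]
      congr 2
      group)
    have hlin : (∑ g : G, V.ρ (g * σ * g⁻¹)) = c • (LinearMap.id : V →ₗ[ℂ] V) := by
      ext v; simpa using hc v
    have htr := congrArg (LinearMap.trace ℂ V) hlin
    have h1 : V.character 1 = Module.finrank ℂ V := V.char_one
    have hd : (Module.finrank ℂ V : ℂ) ≠ 0 := by
      have := Module.finrank_pos (R := ℂ) (M := V)
      exact_mod_cast this.ne'
    have h2 : ∀ g : G, LinearMap.trace ℂ V (V.ρ (g * σ * g⁻¹)) = V.character σ :=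
      fun g ↦ V.char_conj σ g
    rw [map_sum, Finset.sum_congr rfl fun g _ ↦ h2 g] at htr
    simp only [Finset.sum_const, Finset.card_univ, nsmul_eq_mul, map_smul, LinearMap.trace_id,
      smul_eq_mul] at htr
    intro v
    have := hc v
    rw [LinearMap.sum_apply] at this
    rw [this, h1, mul_div_assoc', htr, mul_div_assoc, div_self hd, mul_one]

theorem sum_card_filter_sq {ι X : Type} [Fintype ι] [Fintype X] [DecidableEq X] (f : ι → X) :
    ∑ y, ((Finset.univ.filter fun i ↦ f i = y).card : ℝ) ^ 2 =
      ∑ k : ι, ∑ i : ι, if f i = f k then (1 : ℝ) else 0 := by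
  have e1 : ∀ y, ((Finset.univ.filter fun i ↦ f i = y).card : ℝ) ^ 2 =
      ∑ k : ι, if f k = y then ((Finset.univ.filter fun i ↦ f i = y).card : ℝ) else 0 := by
    intro y
    rw [← Finset.sum_filter, Finset.sum_const, nsmul_eq_mul, sq]
  rw [Finset.sum_congr rfl fun y _ ↦ e1 y, Finset.sum_comm]
  refine Finset.sum_congr rfl fun k _ ↦ ?_
  rw [Finset.sum_ite_eq, if_pos (Finset.mem_univ _), Finset.card_filter, Nat.cast_sum]
  refine Finset.sum_congr rfl fun i _ ↦ ?_
  push_cast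
  rfl

theorem sum_card_conj_smul_sq {G X : Type} [Group G] [Fintype G] [Fintype X] [DecidableEq X]
    [MulAction G X] (σ : G) :
    ∑ x : X, ∑ y, ((Finset.univ.filter fun g : G ↦ (g * σ * g⁻¹) • x = y).card : ℝ) ^ 2 =
      Fintype.card G *
        ∑ g : G, ((Finset.univ.filter fun x : X ↦ (g * σ * g⁻¹) • x = σ • x).card : ℝ) := by
  rw [Finset.sum_congr rfl fun x _ ↦ sum_card_filter_sq fun g : G ↦ (g * σ * g⁻¹) • x,
    Finset.sum_comm, Finset.sum_congr rfl (g := fun k : G ↦ ∑ g : G,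
      ((Finset.univ.filter fun x : X ↦ (g * σ * g⁻¹) • x = σ • x).card : ℝ))]
  · simp
  intro k _
  rw [Finset.sum_comm]
  refine (Fintype.sum_equiv (Equiv.mulLeft k) _ _ fun g ↦ ?_).symm
  rw [Finset.card_filter, Nat.cast_sum]
  refine Fintype.sum_equiv (MulAction.toPerm k) _ _ fun x ↦ ?_
  simp only [Equiv.coe_mulLeft, MulAction.toPerm_apply, smul_smul]
  have : (k * g * σ * (k * g)⁻¹ * k) • x = (k * σ * k⁻¹ * k) • x ↔
      (g * σ * g⁻¹) • x = σ • x := by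
    rw [show k * g * σ * (k * g)⁻¹ * k = k * (g * σ * g⁻¹) by group,
      show k * σ * k⁻¹ * k = k * σ by group, mul_smul k, mul_smul k, smul_left_cancel_iff]
  simp only [this, Nat.cast_ite, Nat.cast_one, Nat.cast_zero]

theorem Representation.exists_equivariant {G V X : Type} [Group G] [AddCommGroup V] [Module ℂ V]
    [MulAction G X] (ρ : Representation ℂ G V) (x₀ : X) {v : V}
    (hfix : ∀ g : G, g • x₀ = x₀ → ρ g v = v) :
    ∃ u : X → V, (∀ (g : G) x, ρ g (u x) = u (g • x)) ∧ u x₀ = v ∧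
      ∀ x, (∀ g : G, g • x₀ ≠ x) → u x = 0 := by
  classical
  have key : ∀ g k : G, g • x₀ = k • x₀ → ρ g v = ρ k v := by
    intro g k hgk
    have := hfix (k⁻¹ * g) (by rw [mul_smul, hgk, inv_smul_smul])
    calc ρ g v = ρ k (ρ (k⁻¹ * g) v) := by
          rw [← Module.End.mul_apply, ← map_mul, mul_inv_cancel_left]
      _ = _ := by rw [this]
  let u : X → V := fun x ↦ if hx : ∃ g : G, g • x₀ = x then ρ hx.choose v else 0
  have hu' : ∀ g : G, u (g • x₀) = ρ g v := by
    intro g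
    have hx : ∃ k : G, k • x₀ = g • x₀ := ⟨g, rfl⟩
    simp only [u, dif_pos hx]
    exact key _ _ hx.choose_spec
  refine ⟨u, fun g x ↦ ?_, ?_, fun x hx ↦ dif_neg fun h ↦ hx _ h.choose_spec⟩
  · by_cases hx : ∃ k : G, k • x₀ = x
    · obtain ⟨k, rfl⟩ := hx
      rw [hu', smul_smul, hu', map_mul, Module.End.mul_apply]
    · have hx' : ¬ ∃ k : G, k • x₀ = g • x := by
        rintro ⟨k, hk⟩
        exact hx ⟨g⁻¹ * k, by rw [mul_smul, hk, inv_smul_smul]⟩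
      simp [u, dif_neg hx, dif_neg hx']
  · have := hu' 1
    rwa [one_smul, map_one, Module.End.one_apply] at this

namespace IsScalarIrr

variable {G V : Type} [Group G] [Fintype G] [AddCommGroup V] [Module ℂ V]
  {ρ : Representation ℂ G V} {lam : G → ℂ}

theorem eq_zero_of_forall_functional (h : IsScalarIrr ρ lam) {v : V} (hv : v ≠ 0)
    (l : Module.Dual ℂ V) (hl : ∀ g, l (ρ g v) = 0) : l = 0 := by
  let W : Submodule ℂ V :=
    { carrier := {w | ∀ g, l (ρ g w) = 0}
      add_mem' := fun ha hb g ↦ by simp [ha g, hb g]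
      zero_mem' := fun g ↦ by simp
      smul_mem' := fun c w hw g ↦ by simp [hw g] }
  have hW : ∀ g, ∀ w ∈ W, ρ g w ∈ W := by
    intro g w hw k
    rw [← Module.End.mul_apply, ← map_mul]
    exact hw _
  rcases h.irr W hW with h0 | h0
  · have : v ∈ W := hl
    rw [h0, Submodule.mem_bot] at this
    exact absurd this hv
  · ext w
    have : w ∈ W := h0 ▸ Submodule.mem_top
    simpa using this 1

theorem lam_eq_of_smul (h : IsScalarIrr ρ lam) {c : ℂ} {σ : G}
    (hc : ∀ v, ∑ g : G, ρ (g * σ * g⁻¹) v = ((Fintype.card G : ℂ) * c) • v) : lam σ = c := by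
  have := h.nontrivial
  obtain ⟨v, hv⟩ := exists_ne (0 : V)
  have h1 := (h.avg σ v).symm.trans (hc v)
  have h2 := smul_left_injective ℂ hv h1
  have hG : (Fintype.card G : ℂ) ≠ 0 := by exact_mod_cast Fintype.card_ne_zero
  exact mul_left_cancel₀ hG h2

theorem lam_conj (h : IsScalarIrr ρ lam) (k σ : G) : lam (k * σ * k⁻¹) = lam σ := by
  apply h.lam_eq_of_smul
  intro v
  rw [← h.avg σ v]
  refine Fintype.sum_equiv (Equiv.mulRight k) _ _ fun g ↦ ?_
  simp only [Equiv.coe_mulRight]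
  congr 2
  group

theorem lam_mul_lam (h : IsScalarIrr ρ lam) (σ τ : G) :
    (Fintype.card G : ℂ) * (lam σ * lam τ) = ∑ g : G, lam (g * σ * g⁻¹ * τ) := by
  have := h.nontrivial
  obtain ⟨v, hv⟩ := exists_ne (0 : V)
  have hG : (Fintype.card G : ℂ) ≠ 0 := by exact_mod_cast Fintype.card_ne_zero
  apply mul_left_cancel₀ hG
  apply smul_left_injective ℂ hv
  simp only
  calc _ = ∑ k : G, ∑ g : G, ρ (g * σ * g⁻¹) (ρ (k * τ * k⁻¹) v) := by
        rw [Finset.sum_congr rfl fun k _ ↦ h.avg σ (ρ (k * τ * k⁻¹) v), ← Finset.smul_sum,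
          h.avg τ v, smul_smul]
        congr 1; ring
    _ = ∑ k : G, ∑ g : G, ρ (k * (g * σ * g⁻¹ * τ) * k⁻¹) v := by
        refine Finset.sum_congr rfl fun k _ ↦
          (Fintype.sum_equiv (Equiv.mulLeft k) _ _ fun g ↦ ?_).symm
        rw [← Module.End.mul_apply, ← map_mul, Equiv.coe_mulLeft]
        congr 2
        group
    _ = _ := by
        rw [Finset.sum_comm, Finset.sum_congr rfl fun g _ ↦ h.avg _ v, ← Finset.sum_smul,
          Finset.mul_sum]

theorem norm_lam_le_one (h : IsScalarIrr ρ lam) (σ : G) : ‖lam σ‖ ≤ 1 := by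
  have := h.nontrivial
  obtain ⟨v, hv⟩ := exists_ne (0 : V)
  obtain ⟨l, hl⟩ : ∃ l : Module.Dual ℂ V, l v ≠ 0 := by
    by_contra hcon
    push Not at hcon
    exact hv ((Module.forall_dual_apply_eq_zero_iff ℂ v).mp hcon)
  obtain ⟨g₀, -, hg₀⟩ := Finset.exists_max_image (Finset.univ : Finset G) (fun g ↦ ‖l (ρ g v)‖)
    ⟨1, Finset.mem_univ _⟩
  have hM : 0 < ‖l (ρ g₀ v)‖ := by
    refine lt_of_lt_of_le ?_ (hg₀ 1 (Finset.mem_univ _))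
    simpa using hl
  have h1 := congrArg (fun w ↦ ‖l w‖) (h.avg σ (ρ g₀ v))
  simp only [map_sum, map_smul, smul_eq_mul, norm_mul, Complex.norm_natCast] at h1
  have h2 : ‖∑ g : G, l (ρ (g * σ * g⁻¹) (ρ g₀ v))‖ ≤ Fintype.card G * ‖l (ρ g₀ v)‖ := by
    refine (norm_sum_le _ _).trans ?_
    refine (Finset.sum_le_card_nsmul _ _ ‖l (ρ g₀ v)‖ fun g _ ↦ ?_).trans (by simp)
    rw [← Module.End.mul_apply, ← map_mul]
    exact hg₀ _ (Finset.mem_univ _)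
  rw [h1] at h2
  have hG : (0 : ℝ) < Fintype.card G := by exact_mod_cast Fintype.card_pos
  have h3 : Fintype.card G * ‖l (ρ g₀ v)‖ * ‖lam σ‖ ≤ Fintype.card G * ‖l (ρ g₀ v)‖ * 1 := by
    linarith
  exact le_of_mul_le_mul_left h3 (by positivity)

theorem finrank_mul_sq_le_of_equivariant [FiniteDimensional ℂ V] (h : IsScalarIrr ρ lam)
    {X : Type} [Fintype X] [DecidableEq X] [MulAction G X] (u : X → V)
    (hu : ∀ (g : G) x, ρ g (u x) = u (g • x)) (x₀ : X) (hx₀ : u x₀ ≠ 0) (σ : G) :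
    (Module.finrank ℂ V : ℝ) * ‖lam σ‖ ^ 2 * Fintype.card G ≤
      ∑ g : G, ((Finset.univ.filter fun x : X ↦ (g * σ * g⁻¹) • x = σ • x).card : ℝ) := by
  classical
  let Z : X → X → ℝ := fun x y ↦ ((Finset.univ.filter fun g : G ↦ (g * σ * g⁻¹) • x = y).card : ℝ)
  let Φ : Module.Dual ℂ V →ₗ[ℂ] EuclideanSpace ℂ X :=
    { toFun := fun l ↦ WithLp.toLp 2 fun x ↦ l (u x)
      map_add' := fun a b ↦ by ext; simp
      map_smul' := fun a b ↦ by ext; simp }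
  have hΦ : Function.Injective Φ := by
    rw [← LinearMap.ker_eq_bot, LinearMap.ker_eq_bot']
    intro l hl
    refine h.eq_zero_of_forall_functional hx₀ l fun g ↦ ?_
    rw [hu]
    exact congrFun (congrArg (fun f : EuclideanSpace ℂ X ↦ (f : X → ℂ)) hl) (g • x₀)
  let S := LinearMap.range Φ
  have hS : Module.finrank ℂ S = Module.finrank ℂ V := by
    rw [LinearMap.finrank_range_of_inj hΦ, Subspace.dual_finrank_eq]
  let b := stdOrthonormalBasis ℂ S
  have hZ : ∀ F ∈ S, ∀ x, ∑ y, (Z x y : ℂ) * F y = Fintype.card G * lam σ * F x := by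
    rintro _ ⟨l, rfl⟩ x
    have h1 := congrArg l (h.avg σ (u x))
    rw [map_smul, map_sum] at h1
    simp only [hu] at h1
    change _ = _ * l (u x)
    rw [← smul_eq_mul (_ * _), ← h1]
    rw [← Finset.sum_fiberwise_of_maps_to (s := Finset.univ) (t := Finset.univ)
      (g := fun g : G ↦ (g * σ * g⁻¹) • x) (fun _ _ ↦ Finset.mem_univ _)]
    refine Finset.sum_congr rfl fun y _ ↦ ?_
    rw [Finset.sum_congr rfl (g := fun _ ↦ l (u y))
      (fun g hg ↦ by rw [(Finset.mem_filter.mp hg).2]), Finset.sum_const, nsmul_eq_mul]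
    simp [Z, Φ]
  let z : X → EuclideanSpace ℂ X := fun x ↦ WithLp.toLp 2 fun y ↦ (Z x y : ℂ)
  have hB : ∀ x, ∑ i, ‖(b i : EuclideanSpace ℂ X) x‖ ^ 2 * (Fintype.card G * ‖lam σ‖) ^ 2 ≤
      ∑ y, Z x y ^ 2 := by
    intro x
    have ho : Orthonormal ℂ fun i ↦ (b i : EuclideanSpace ℂ X) :=
      b.orthonormal.comp_linearIsometry S.subtypeₗᵢ
    have h1 := ho.sum_inner_products_le (z x) (s := Finset.univ)
    have h2 : ‖z x‖ ^ 2 = ∑ y, Z x y ^ 2 := by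
      rw [EuclideanSpace.norm_sq_eq]
      simp [z]
    rw [← h2]
    refine le_trans (le_of_eq (Finset.sum_congr rfl fun i _ ↦ ?_)) h1
    rw [norm_inner_symm]
    have h3 := hZ _ (b i).2 x
    have h4 : inner ℂ (z x) (b i : EuclideanSpace ℂ X) = ∑ y, (Z x y : ℂ) *
        (b i : EuclideanSpace ℂ X) y := by
      simp [PiLp.inner_apply, z, mul_comm]
    rw [h4, h3, norm_mul, norm_mul, Complex.norm_natCast]
    ring
  have hsum := Finset.sum_le_sum fun x (_ : x ∈ Finset.univ) ↦ hB x
  rw [Finset.sum_comm] at hsum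
  have hb1 : ∀ i, ∑ x, ‖(b i : EuclideanSpace ℂ X) x‖ ^ 2 = 1 := by
    intro i
    rw [← EuclideanSpace.norm_sq_eq]
    have := b.orthonormal.1 i
    rw [Submodule.coe_norm] at this
    rw [this]; norm_num
  simp only [← Finset.sum_mul, hb1, one_mul, Finset.sum_const, Finset.card_univ,
    Fintype.card_fin, nsmul_eq_mul, hS] at hsum
  have hcount : ∑ x, ∑ y, Z x y ^ 2 = Fintype.card G *
      ∑ g : G, ((Finset.univ.filter fun x : X ↦ (g * σ * g⁻¹) • x = σ • x).card : ℝ) :=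
    sum_card_conj_smul_sq σ
  rw [hcount] at hsum
  have hG : (0 : ℝ) < Fintype.card G := by exact_mod_cast Fintype.card_pos
  refine le_of_mul_le_mul_left ?_ hG
  calc _ = (Module.finrank ℂ V : ℝ) * (Fintype.card G * ‖lam σ‖) ^ 2 := by ring
    _ ≤ _ := hsum

theorem finrank_mul_sq_le_of_stabilizer [FiniteDimensional ℂ V] (h : IsScalarIrr ρ lam)
    {X : Type} [Fintype X] [DecidableEq X] [MulAction G X] (x₀ : X) {v : V} (hv : v ≠ 0)
    (hfix : ∀ g : G, g • x₀ = x₀ → ρ g v = v) (σ : G) :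
    (Module.finrank ℂ V : ℝ) * ‖lam σ‖ ^ 2 * Fintype.card G ≤
      ∑ g : G, ((Finset.univ.filter fun x : X ↦ (g * σ * g⁻¹) • x = σ • x).card : ℝ) := by
  obtain ⟨u, hu, h₀, -⟩ := Representation.exists_equivariant ρ x₀ hfix
  exact h.finrank_mul_sq_le_of_equivariant u hu x₀ (h₀ ▸ hv) σ

theorem finrank_mul_sq_le_centralizer [FiniteDimensional ℂ V] [DecidableEq G]
    (h : IsScalarIrr ρ lam) (σ : G) :
    (Module.finrank ℂ V : ℝ) * ‖lam σ‖ ^ 2 ≤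
      ((Finset.univ.filter fun g : G ↦ g * σ = σ * g).card : ℝ) := by
  have := h.nontrivial
  obtain ⟨v, hv⟩ := exists_ne (0 : V)
  have h1 := h.finrank_mul_sq_le_of_stabilizer (X := G) (1 : G) hv (fun g hg ↦ by
    have : g = 1 := by simpa using hg
    simp [this]) σ
  have hG : (0 : ℝ) < Fintype.card G := by exact_mod_cast Fintype.card_pos
  refine le_of_mul_le_mul_right (h1.trans (le_of_eq ?_)) hG
  have : ∀ g : G, ((Finset.univ.filter fun x : G ↦ (g * σ * g⁻¹) • x = σ • x).card : ℝ) =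
      if g * σ = σ * g then (Fintype.card G : ℝ) else 0 := by
    intro g
    simp only [smul_eq_mul, mul_left_inj, mul_inv_eq_iff_eq_mul]
    split_ifs with hg <;> simp [hg]
  simp only [this, ← Finset.sum_filter, Finset.sum_const, nsmul_eq_mul]

end IsScalarIrr

theorem card_perm_comp_eq_le {α ι : Type} [Fintype α] [DecidableEq α] [Fintype ι]
    (e e' : ι → α) (he : Function.Injective e) :
    (Finset.univ.filter fun g : Equiv.Perm α ↦ ∀ i, g (e i) = e' i).card ≤
      (Fintype.card α - Fintype.card ι).factorial := by
  classical
  rcases (Finset.univ.filter fun g : Equiv.Perm α ↦ ∀ i, g (e i) = e' i).eq_empty_or_nonempty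
    with h0 | ⟨g₀, hg₀⟩
  · rw [h0]; simp
  simp only [Finset.mem_filter, Finset.mem_univ, true_and] at hg₀
  let p : α → Prop := fun a ↦ a ∉ Set.range e
  have h1 : Fintype.card {a // p a} = Fintype.card α - Fintype.card ι := by
    rw [Fintype.card_subtype_compl]
    congr 1
    exact Set.card_range_of_injective he
  rw [← h1, ← Fintype.card_perm, Fintype.card_congr (Equiv.Perm.subtypeEquivSubtypePerm p),
    ← Finset.card_univ]
  refine Finset.card_le_card_of_surjOn (fun f ↦ g₀ * f.1) ?_
  intro g hg
  simp only [Finset.coe_filter, Finset.mem_univ, true_and, Set.mem_ofPred_eq] at hg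
  refine ⟨⟨g₀⁻¹ * g, fun a ha ↦ ?_⟩, by simp, by simp⟩
  obtain ⟨i, rfl⟩ : a ∈ Set.range e := by simpa [p] using ha
  rw [Equiv.Perm.mul_apply, hg, ← hg₀]
  simp

theorem exists_subset_disjoint_image_card {α : Type} [DecidableEq α] (σ : Equiv.Perm α)
    (C : Finset α) (hC : ∀ x ∈ C, σ x ≠ x) :
    ∃ Y ⊆ C, (∀ x ∈ Y, σ x ∉ Y) ∧ C.card ≤ 3 * Y.card := by
  obtain ⟨Y, hY⟩ := (C.powerset.filter fun Y ↦ ∀ x ∈ Y, σ x ∉ Y).exists_maximal ⟨∅, by simp⟩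
  have hYm : Y ⊆ C ∧ ∀ x ∈ Y, σ x ∉ Y := by simpa using hY.prop
  refine ⟨Y, hYm.1, hYm.2, ?_⟩
  have hsub : C ⊆ Y ∪ (Y.image σ ∪ Y.image σ.symm) := by
    intro z hz
    by_contra hcon
    simp only [Finset.mem_union, Finset.mem_image, not_or, not_exists, not_and] at hcon
    obtain ⟨h1, h2, h3⟩ := hcon
    have h4 : σ z ∉ Y := fun h ↦ h3 _ h (σ.symm_apply_apply z)
    have h5 : insert z Y ∈ C.powerset.filter fun Y ↦ ∀ x ∈ Y, σ x ∉ Y := by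
      simp only [Finset.mem_filter, Finset.mem_powerset, Finset.insert_subset_iff,
        Finset.mem_insert, forall_eq_or_imp, not_or]
      exact ⟨⟨hz, hYm.1⟩, ⟨hC z hz, h4⟩, fun x hx ↦ ⟨h2 x hx, hYm.2 x hx⟩⟩
    exact h1 (hY.le_of_ge h5 (Finset.subset_insert z Y) (Finset.mem_insert_self z Y))
  calc C.card ≤ _ := Finset.card_le_card hsub
    _ ≤ Y.card + (Y.card + Y.card) := by
      refine (Finset.card_union_le _ _).trans (Nat.add_le_add_left ?_ _)
      exact (Finset.card_union_le _ _).trans (Nat.add_le_add Finset.card_image_le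
        Finset.card_image_le)
    _ = _ := by ring

section
variable {n : ℕ} (σ : Equiv.Perm (Fin n))

/-- The points where `σ` agrees with its conjugate by `g`. -/
def agreeSet (g : Equiv.Perm (Fin n)) : Finset (Fin n) :=
  Finset.univ.filter fun i ↦ (g * σ * g⁻¹) i = σ i

variable {σ} in
theorem mem_agreeSet {g : Equiv.Perm (Fin n)} {i : Fin n} :
    i ∈ agreeSet σ g ↔ (g * σ * g⁻¹) i = σ i := by
  rw [agreeSet, Finset.mem_filter_univ]

/-- Tuples `y` in `agreeSet σ g` such that `y` and `σ ∘ y` together list distinct points. -/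
def freeTuples (s : ℕ) (g : Equiv.Perm (Fin n)) : Finset (Fin s → Fin n) :=
  Finset.univ.filter fun y ↦ Function.Injective (Sum.elim y (σ ∘ y)) ∧
    ∀ i, (g * σ * g⁻¹) (y i) = σ (y i)

theorem sum_card_freeTuples_le (s : ℕ) :
    ∑ g, (freeTuples σ s g).card ≤ n ^ (2 * s) * (n - 2 * s).factorial := by
  classical
  calc ∑ g, (freeTuples σ s g).card
      ≤ ∑ g : Equiv.Perm (Fin n), ∑ y : Fin s → Fin n, ∑ y' : Fin s → Fin n,
          if Function.Injective (Sum.elim y' (σ ∘ y')) ∧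
            ∀ i, g (Sum.elim y' (σ ∘ y') i) = Sum.elim y (σ ∘ y) i then 1 else 0 := by
        refine Finset.sum_le_sum fun g _ ↦ ?_
        rw [freeTuples, Finset.card_filter]
        refine Finset.sum_le_sum fun y _ ↦ ?_
        split_ifs with h
        · have h1 : ∀ i, g (Sum.elim (⇑g⁻¹ ∘ y) (σ ∘ (⇑g⁻¹ ∘ y)) i) = Sum.elim y (σ ∘ y) i := by
            rintro (i | i)
            · simp
            · simpa using h.2 i
          refine le_trans (le_of_eq ?_) (Finset.single_le_sum
            (f := fun y' : Fin s → Fin n ↦ if Function.Injective (Sum.elim y' (σ ∘ y')) ∧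
            ∀ i, g (Sum.elim y' (σ ∘ y') i) = Sum.elim y (σ ∘ y) i then 1 else 0)
            (fun _ _ ↦ Nat.zero_le _) (Finset.mem_univ (⇑g⁻¹ ∘ y)))
          symm
          refine if_pos ⟨?_, h1⟩
          have h2 : Function.Injective (g ∘ Sum.elim (⇑g⁻¹ ∘ y) (σ ∘ (⇑g⁻¹ ∘ y))) := by
            rw [show g ∘ Sum.elim (⇑g⁻¹ ∘ y) (σ ∘ (⇑g⁻¹ ∘ y)) = Sum.elim y (σ ∘ y) from
              funext h1]
            exact h.1
          exact h2.of_comp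
        · exact Nat.zero_le _
    _ = ∑ y : Fin s → Fin n, ∑ y' : Fin s → Fin n, ∑ g : Equiv.Perm (Fin n),
          if Function.Injective (Sum.elim y' (σ ∘ y')) ∧
            ∀ i, g (Sum.elim y' (σ ∘ y') i) = Sum.elim y (σ ∘ y) i then 1 else 0 := by
        rw [Finset.sum_comm]
        exact Finset.sum_congr rfl fun y _ ↦ Finset.sum_comm
    _ ≤ ∑ y : Fin s → Fin n, ∑ y' : Fin s → Fin n, (n - 2 * s).factorial := by
        refine Finset.sum_le_sum fun y _ ↦ Finset.sum_le_sum fun y' _ ↦ ?_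
        rw [← Finset.card_filter]
        by_cases h : Function.Injective (Sum.elim y' (σ ∘ y'))
        · simp only [h, true_and]
          refine (card_perm_comp_eq_le _ (Sum.elim y (σ ∘ y)) h).trans (le_of_eq ?_)
          simp [two_mul]
        · simp [h]
    _ = _ := by
        simp only [Finset.sum_const, Finset.card_univ, Fintype.card_fun, Fintype.card_fin,
          smul_eq_mul]
        ring

theorem sum_card_freeTuples_le_two_mul (s : ℕ) (hs : 8 * s ^ 2 ≤ n) (hn : 0 < n) :
    ∑ g, (freeTuples σ s g).card ≤ 2 * n.factorial := by
  refine (sum_card_freeTuples_le σ s).trans ?_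
  have hsn : 2 * s ≤ n := by nlinarith
  have h1 : (n - 2 * s).factorial * n.descFactorial (2 * s) = n.factorial :=
    Nat.factorial_mul_descFactorial hsn
  have h2 : (n - 2 * s) ^ (2 * s) ≤ n.descFactorial (2 * s) :=
    (Nat.pow_le_pow_left (by omega) _).trans (Nat.pow_sub_le_descFactorial n (2 * s))
  have h3 : n ^ (2 * s) ≤ 2 * (n - 2 * s) ^ (2 * s) := by
    have hn' : (0 : ℝ) < n := by exact_mod_cast hn
    have hb := one_add_mul_le_pow (a := -(2 * s / n : ℝ)) (by
      rw [neg_le_neg_iff, div_le_iff₀ hn']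
      have : (2 * s : ℝ) ≤ n := by exact_mod_cast hsn
      linarith) (2 * s)
    have h4 : (1 / 2 : ℝ) ≤ 1 + ((2 * s : ℕ) : ℝ) * -(2 * s / n : ℝ) := by
      have : ((2 * s : ℕ) : ℝ) * (2 * s / n : ℝ) ≤ 1 / 2 := by
        rw [mul_div_assoc', div_le_iff₀ hn']
        have : (8 * s ^ 2 : ℝ) ≤ n := by exact_mod_cast hs
        push_cast
        linarith
      linarith
    have h5 : (1 : ℝ) + -(2 * s / n) = ((n - 2 * s : ℕ) : ℝ) / n := by
      rw [Nat.cast_sub hsn]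
      field_simp
      push_cast
      ring
    have h6 := h4.trans hb
    rw [h5, div_pow, le_div_iff₀ (by positivity)] at h6
    have : ((n ^ (2 * s) : ℕ) : ℝ) ≤ ((2 * (n - 2 * s) ^ (2 * s) : ℕ) : ℝ) := by
      push_cast at h6 ⊢
      linarith
    exact_mod_cast this
  calc n ^ (2 * s) * (n - 2 * s).factorial
      ≤ 2 * n.descFactorial (2 * s) * (n - 2 * s).factorial :=
        Nat.mul_le_mul_right _ (h3.trans (Nat.mul_le_mul_left _ h2))
    _ = 2 * n.factorial := by rw [← h1]; ring

theorem descFactorial_le_card_freeTuples (s : ℕ) (g : Equiv.Perm (Fin n)) {Y : Finset (Fin n)}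
    (hY : Y ⊆ agreeSet σ g) (hσ : ∀ x ∈ Y, σ x ∉ Y) :
    Y.card.descFactorial s ≤ (freeTuples σ s g).card := by
  have h1 : Y.card.descFactorial s = (Finset.univ : Finset (Fin s ↪ Y)).card := by
    simp [Fintype.card_embedding_eq]
  rw [h1]
  refine Finset.card_le_card_of_injOn (fun e i ↦ (e i : Fin n)) ?_ ?_
  · intro e _
    simp only [freeTuples, Finset.coe_filter, Finset.mem_univ, true_and, Set.mem_ofPred_eq]
    refine ⟨?_, fun i ↦ ?_⟩
    · have hi : Function.Injective fun i ↦ (e i : Fin n) :=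
        Subtype.val_injective.comp e.injective
      refine hi.sumElim (σ.injective.comp hi) fun i j hij ↦ ?_
      have h2 : (e i : Fin n) = σ (e j) := hij
      exact hσ _ (e j).2 (h2 ▸ (e i).2)
    · exact mem_agreeSet.mp (hY (e i).2)
  · intro e _ e' _ h
    ext i
    exact congrArg Fin.val (congrFun h i)

theorem card_agreeSet_pow_le (hσ : fixCount σ ≤ 2) (s : ℕ) (hs : 1 ≤ s)
    (g : Equiv.Perm (Fin n)) :
    (agreeSet σ g).card ^ s ≤ (8 * s) ^ s + 8 ^ s * (freeTuples σ s g).card := by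
  obtain ⟨Y, hYC, hY, hcard⟩ := exists_subset_disjoint_image_card σ
    ((agreeSet σ g).filter fun x ↦ σ x ≠ x) (fun x hx ↦ (Finset.mem_filter.mp hx).2)
  have hc : (agreeSet σ g).card ≤ 3 * Y.card + 2 := by
    rw [← Finset.card_filter_add_card_filter_not (s := agreeSet σ g) (fun x ↦ σ x ≠ x)]
    refine Nat.add_le_add hcard (le_trans (Finset.card_le_card ?_) hσ)
    intro x hx
    simp only [Finset.mem_filter, not_not] at hx
    simpa using hx.2
  rcases lt_or_ge Y.card (2 * s) with h | h
  · exact (Nat.pow_le_pow_left (by omega) s).trans (Nat.le_add_right _ _)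
  · have h1 := descFactorial_le_card_freeTuples σ s g
      (hYC.trans (Finset.filter_subset _ _)) hY
    refine le_trans ?_ (Nat.le_add_left _ _)
    refine le_trans ?_ (Nat.mul_le_mul_left _ h1)
    refine le_trans ?_ (Nat.mul_le_mul_left _ (Nat.pow_sub_le_descFactorial _ _))
    rw [← mul_pow]
    exact Nat.pow_le_pow_left (by omega) s

theorem sum_card_agreeSet_pow_le (hσ : fixCount σ ≤ 2) (s : ℕ) (hs : 1 ≤ s)
    (hsn : 8 * s ^ 2 ≤ n) :
    ∑ g, (agreeSet σ g).card ^ s ≤ 3 * (8 * s) ^ s * n.factorial := by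
  have h1 := sum_card_freeTuples_le_two_mul σ s hsn (by nlinarith)
  calc ∑ g, (agreeSet σ g).card ^ s
      ≤ ∑ g, ((8 * s) ^ s + 8 ^ s * (freeTuples σ s g).card) :=
        Finset.sum_le_sum fun g _ ↦ card_agreeSet_pow_le σ hσ s hs g
    _ = n.factorial * (8 * s) ^ s + 8 ^ s * ∑ g, (freeTuples σ s g).card := by
        rw [Finset.sum_add_distrib, ← Finset.mul_sum]
        simp [Fintype.card_perm]
    _ ≤ n.factorial * (8 * s) ^ s + (8 * s) ^ s * (2 * n.factorial) := by
        gcongr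
        omega
    _ = _ := by ring

end

theorem IsScalarIrr.finrank_mul_sq_le_of_fix_tuple {n : ℕ} {V : Type} [AddCommGroup V]
    [Module ℂ V] [FiniteDimensional ℂ V] {ρ : Representation ℂ (Equiv.Perm (Fin n)) V}
    {lam : Equiv.Perm (Fin n) → ℂ} (h : IsScalarIrr ρ lam) {σ : Equiv.Perm (Fin n)}
    (hσ : fixCount σ ≤ 2) {s : ℕ} (hs : 1 ≤ s) (hsn : 8 * s ^ 2 ≤ n) (x : Fin s → Fin n)
    {v : V} (hv : v ≠ 0) (hfix : ∀ g : Equiv.Perm (Fin n), (∀ i, g (x i) = x i) → ρ g v = v) :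
    (Module.finrank ℂ V : ℝ) * ‖lam σ‖ ^ 2 ≤ 3 * (8 * s : ℝ) ^ s := by
  have h1 := h.finrank_mul_sq_le_of_stabilizer x hv (fun g hg ↦ hfix g (congrFun hg)) σ
  have h2 : ∀ g : Equiv.Perm (Fin n),
      (Finset.univ.filter fun x : Fin s → Fin n ↦ (g * σ * g⁻¹) • x = σ • x).card =
        (agreeSet σ g).card ^ s := by
    intro g
    have : (Finset.univ.filter fun x : Fin s → Fin n ↦ (g * σ * g⁻¹) • x = σ • x) =
        Fintype.piFinset fun _ ↦ agreeSet σ g := by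
      ext y
      simp only [Finset.mem_filter_univ, Fintype.mem_piFinset, mem_agreeSet, funext_iff]
      rfl
    rw [this, Fintype.card_piFinset]
    simp
  simp only [h2] at h1
  have h3 := sum_card_agreeSet_pow_le σ hσ s hs hsn
  have h4 : (∑ g, ((agreeSet σ g).card ^ s : ℕ) : ℝ) ≤ 3 * (8 * s : ℝ) ^ s * n.factorial := by
    exact_mod_cast h3
  have h5 := h1.trans h4
  rw [Fintype.card_perm, Fintype.card_fin] at h5
  exact le_of_mul_le_mul_right h5 (by positivity)

section
variable {α : Type} [DecidableEq α] (σ : Equiv.Perm α) (y : Bool → Bool → ℝ)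

/-- The sum of `y a b ^ 2` over all values `a`, `b` at the endpoints of the edge `(x, σ x)`, where
an endpoint outside `S` takes the value prescribed by `f`. -/
noncomputable def edgeMass (S : Finset α) (x : α) (f : α → Bool) : ℝ :=
  ∑ a, ∑ b, if (x ∈ S ∨ a = f x) ∧ (σ x ∈ S ∨ b = f (σ x)) then y a b ^ 2 else 0

theorem edgeMass_nonneg (S : Finset α) (x : α) (f : α → Bool) : 0 ≤ edgeMass σ y S x f := by
  unfold edgeMass
  refine Finset.sum_nonneg fun a _ ↦ Finset.sum_nonneg fun b _ ↦ ?_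
  split_ifs <;> positivity

theorem edgeMass_update_of_ne {S : Finset α} {x z : α} (h1 : x ≠ z) (h2 : σ x ≠ z)
    (f : α → Bool) (c : Bool) :
    edgeMass σ y S x (Function.update f z c) = edgeMass σ y (insert z S) x f := by
  simp [edgeMass, h1, h2]

theorem sum_edgeMass_update_left {S : Finset α} {z : α} (hz : z ∉ S) (h2 : σ z ≠ z)
    (f : α → Bool) :
    ∑ c, edgeMass σ y S z (Function.update f z c) = edgeMass σ y (insert z S) z f := by
  by_cases h3 : σ z ∈ S <;> cases h4 : f (σ z) <;> simp [edgeMass, hz, h2, h3, h4]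

theorem sum_edgeMass_update_right {S : Finset α} {x z : α} (hz : z ∉ S) (h1 : x ≠ z)
    (h2 : σ x = z) (f : α → Bool) :
    ∑ c, edgeMass σ y S x (Function.update f z c) = edgeMass σ y (insert z S) x f := by
  by_cases h3 : x ∈ S <;> cases h4 : f x <;> simp [edgeMass, hz, h1, h2, h3, h4] <;> ring

theorem sum_sqrt_edgeMass_update_self {S : Finset α} {z : α} (hz : z ∉ S) (h2 : σ z = z)
    (f : α → Bool) :
    ∑ c, √(edgeMass σ y S z (Function.update f z c)) ≤
      √2 * √(edgeMass σ y (insert z S) z f) := by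
  simp only [edgeMass, h2, hz, Finset.mem_insert_self, Function.update_self, Fintype.sum_bool]
  simp
  rw [← Real.sqrt_mul (by norm_num)]
  refine Real.le_sqrt_of_sq_le ?_
  have h1 := sq_abs (y true true)
  have h3 := sq_abs (y false false)
  rw [Real.sqrt_sq_eq_abs, Real.sqrt_sq_eq_abs]
  nlinarith [sq_nonneg (|y true true| - |y false false|), sq_nonneg (y true false),
    sq_nonneg (y false true)]

/-- The factor `√2` at fixed points of `σ` and `1` elsewhere. -/
noncomputable def fixFactor (z : α) : ℝ := if σ z = z then √2 else 1

variable [Fintype α]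

theorem sum_prod_sqrt_edgeMass_update_le {S : Finset α} {z : α} (hz : z ∉ S) (f : α → Bool) :
    ∑ c, ∏ x, √(edgeMass σ y S x (Function.update f z c)) ≤
      fixFactor σ z * ∏ x, √(edgeMass σ y (insert z S) x f) := by
  by_cases h : σ z = z
  · have h1 : ∀ x ∈ Finset.univ.erase z, ∀ c, √(edgeMass σ y S x (Function.update f z c)) =
        √(edgeMass σ y (insert z S) x f) := by
      intro x hx c
      have hxz := (Finset.mem_erase.mp hx).1
      rw [edgeMass_update_of_ne σ y hxz (fun h' ↦ hxz (σ.injective (h'.trans h.symm)))]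
    simp only [← Finset.mul_prod_erase _ _ (Finset.mem_univ z)]
    rw [Finset.sum_congr rfl fun c _ ↦ by rw [Finset.prod_congr rfl fun x hx ↦ h1 x hx c],
      ← Finset.sum_mul, ← mul_assoc, fixFactor, if_pos h]
    exact mul_le_mul_of_nonneg_right (sum_sqrt_edgeMass_update_self σ y hz h f)
      (Finset.prod_nonneg fun _ _ ↦ Real.sqrt_nonneg _)
  · set w := σ.symm z with hw
    have hσw : σ w = z := by simp [hw]
    have hwz : w ≠ z := fun h' ↦ h (by rw [h'] at hσw; exact hσw)
    have h1 : ∀ x ∈ (Finset.univ.erase z).erase w, ∀ c,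
        √(edgeMass σ y S x (Function.update f z c)) = √(edgeMass σ y (insert z S) x f) := by
      intro x hx c
      simp only [Finset.mem_erase, Finset.mem_univ, and_true] at hx
      rw [edgeMass_update_of_ne σ y hx.2 (fun h' ↦ hx.1 (by rw [hw, ← h']; simp))]
    have hwm : w ∈ Finset.univ.erase z := by simp [hwz]
    simp only [← Finset.mul_prod_erase _ _ (Finset.mem_univ z), ← Finset.mul_prod_erase _ _ hwm]
    rw [Finset.sum_congr rfl fun c _ ↦ by rw [Finset.prod_congr rfl fun x hx ↦ h1 x hx c],
      fixFactor, if_neg h, one_mul]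
    simp only [← mul_assoc]
    rw [← Finset.sum_mul]
    refine mul_le_mul_of_nonneg_right ?_ (Finset.prod_nonneg fun _ _ ↦ Real.sqrt_nonneg _)
    refine (Real.sum_mul_le_sqrt_mul_sqrt _ _ _).trans (le_of_eq ?_)
    simp only [Real.sq_sqrt (edgeMass_nonneg σ y _ _ _)]
    rw [sum_edgeMass_update_left σ y hz h, sum_edgeMass_update_right σ y hz hwz hσw]

theorem two_mul_sum_eq_sum_update (F : (α → Bool) → ℝ) (z : α) :
    2 * ∑ f, F f = ∑ f, ∑ c, F (Function.update f z c) := by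
  let e : Equiv.Perm (α → Bool) := Function.Involutive.toPerm
    (fun f ↦ Function.update f z (!f z)) (fun f ↦ by simp)
  have h1 : ∀ f, ∑ c, F (Function.update f z c) = F f + F (e f) := by
    intro f
    have h2 : e f = Function.update f z (!f z) := rfl
    have h3 : Function.update f z (f z) = f := Function.update_eq_self z f
    rw [Fintype.sum_bool, h2]
    cases h4 : f z <;> rw [h4] at h3 <;> simp [h3, add_comm]
  simp only [h1]
  rw [Finset.sum_add_distrib, Equiv.sum_comp e F]
  ring

theorem two_pow_mul_sum_prod_le (S : Finset α) :
    2 ^ S.card * ∑ f, ∏ x, √(edgeMass σ y ∅ x f) ≤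
      (∏ z ∈ S, fixFactor σ z) * ∑ f, ∏ x, √(edgeMass σ y S x f) := by
  induction S using Finset.induction_on with
  | empty => simp
  | insert z S hz ih =>
    have hnn : 0 ≤ ∏ z ∈ S, fixFactor σ z := by
      refine Finset.prod_nonneg fun z _ ↦ ?_
      unfold fixFactor
      split_ifs <;> positivity
    rw [Finset.card_insert_of_notMem hz, Finset.prod_insert hz, pow_succ]
    calc _ = 2 * (2 ^ S.card * ∑ f, ∏ x, √(edgeMass σ y ∅ x f)) := by ring
      _ ≤ 2 * ((∏ z ∈ S, fixFactor σ z) * ∑ f, ∏ x, √(edgeMass σ y S x f)) := by gcongr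
      _ = (∏ z ∈ S, fixFactor σ z) * (2 * ∑ f, ∏ x, √(edgeMass σ y S x f)) := by ring
      _ ≤ (∏ z ∈ S, fixFactor σ z) *
          ∑ f, fixFactor σ z * ∏ x, √(edgeMass σ y (insert z S) x f) := by
        refine mul_le_mul_of_nonneg_left ?_ hnn
        rw [two_mul_sum_eq_sum_update _ z]
        exact Finset.sum_le_sum fun f _ ↦ sum_prod_sqrt_edgeMass_update_le σ y hz f
      _ = _ := by rw [← Finset.mul_sum]; ring

theorem sum_prod_le_sqrt_two_pow (hy : ∀ a b, 0 ≤ y a b) (hy1 : ∑ a, ∑ b, y a b ^ 2 = 1) :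
    ∑ f : α → Bool, ∏ x, y (f x) (f (σ x)) ≤
      √2 ^ (Finset.univ.filter fun x ↦ σ x = x).card := by
  have h := two_pow_mul_sum_prod_le σ y Finset.univ
  have h1 : ∀ x f, √(edgeMass σ y ∅ x f) = y (f x) (f (σ x)) := by
    intro x f
    rw [← Real.sqrt_sq (hy (f x) (f (σ x)))]
    congr 1
    cases hx : f x <;> cases hσ : f (σ x) <;> simp [edgeMass, hx, hσ]
  have h2 : ∀ x f, √(edgeMass σ y Finset.univ x f) = 1 := by
    intro x f
    have : edgeMass σ y Finset.univ x f = 1 := by rw [← hy1]; simp [edgeMass]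
    rw [this, Real.sqrt_one]
  have h3 : ∏ z, fixFactor σ z = √2 ^ (Finset.univ.filter fun x ↦ σ x = x).card := by
    simp [fixFactor, Finset.prod_ite]
  simp only [h1, h2, h3, Finset.prod_const_one, Finset.sum_const, Finset.card_univ,
    Fintype.card_fun, Fintype.card_bool, nsmul_eq_mul, mul_one] at h
  push_cast at h
  rw [mul_comm] at h
  exact le_of_mul_le_mul_right h (by positivity)

end

section
variable {α β : Type} [Fintype α] [DecidableEq β]

/-- The numbers of points at which `F` takes each value. -/
def fiberCount (F : α → β) (c : β) : ℕ := (Finset.univ.filter fun x ↦ F x = c).card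

theorem sum_fiberCount [Fintype β] (F : α → β) : ∑ c, fiberCount F c = Fintype.card α := by
  rw [← Finset.card_univ, Finset.card_eq_sum_card_fiberwise (f := F) (t := Finset.univ)]
  · rfl
  · simp

theorem fiberCount_comp_perm (F : α → β) (g : Equiv.Perm α) :
    fiberCount (F ∘ g) = fiberCount F := by
  ext c
  exact Finset.card_equiv g fun x ↦ by simp

theorem card_perm_comp_eq_le_prod_factorial [DecidableEq α] [Fintype β] (F K : α → β) :
    (Finset.univ.filter fun g : Equiv.Perm α ↦ F ∘ g = K).card ≤
      if fiberCount F = fiberCount K then ∏ c, (fiberCount K c).factorial else 0 := by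
  rcases (Finset.univ.filter fun g : Equiv.Perm α ↦ F ∘ g = K).eq_empty_or_nonempty
    with h0 | ⟨g₀, hg₀⟩
  · rw [h0]; simp
  simp only [Finset.mem_filter, Finset.mem_univ, true_and] at hg₀
  have h1 : fiberCount F = fiberCount K := by rw [← hg₀, fiberCount_comp_perm]
  rw [if_pos h1]
  have h2 := DomMulAct.stabilizer_card K
  have h3 : ∀ c, Fintype.card {a // K a = c} = fiberCount K c := fun c ↦ Fintype.card_subtype _
  simp only [h3] at h2
  rw [← h2, Fintype.card_subtype]
  refine Finset.card_le_card_of_injOn (fun g ↦ g₀⁻¹ * g) ?_ ?_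
  · intro g hg
    simp only [Finset.coe_filter, Finset.mem_univ, true_and, Set.mem_ofPred_eq] at hg ⊢
    rw [← hg]
    nth_rewrite 1 [hg, ← hg₀]
    ext x
    simp
  · intro g _ g' _ h
    exact mul_left_cancel h

end

theorem factorial_mul_exp_le (N : ℕ) :
    (N.factorial : ℝ) * Real.exp N ≤ 3 * (N + 1) * (N : ℝ) ^ N := by
  have key : ∀ N : ℕ, ((N + 1).factorial : ℝ) * Real.exp (N + 1) ≤
      Real.exp 1 * (N + 1) * ((N : ℝ) + 1) ^ (N + 1) := by
    intro N
    induction N with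
    | zero => simp
    | succ N ih =>
      have h1 : Real.exp 1 * ((N : ℝ) + 1) ^ (N + 2) ≤ ((N : ℝ) + 2) ^ (N + 2) := by
        have h2 := Real.add_one_le_exp (-(1 / ((N : ℝ) + 2)))
        have h3 : -(1 / ((N : ℝ) + 2)) + 1 = (N + 1) / (N + 2) := by field_simp; ring
        rw [h3] at h2
        have h4 := pow_le_pow_left₀ (by positivity) h2 (N + 2)
        rw [← Real.exp_nat_mul, div_pow, div_le_iff₀ (by positivity)] at h4
        have h5 : ((N + 2 : ℕ) : ℝ) * -(1 / ((N : ℝ) + 2)) = -1 := by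
          push_cast; field_simp
        rw [h5] at h4
        calc _ ≤ Real.exp 1 * (Real.exp (-1) * ((N : ℝ) + 2) ^ (N + 2)) := by gcongr
          _ = _ := by rw [← mul_assoc, ← Real.exp_add]; simp
      have h6 : (((N + 1 + 1).factorial : ℕ) : ℝ) = (N + 2) * (N + 1).factorial := by
        rw [Nat.factorial_succ (N + 1)]; push_cast; ring
      rw [h6]
      push_cast
      calc _ = (N + 2) * Real.exp 1 * ((N + 1).factorial * Real.exp (N + 1)) := by
            rw [Real.exp_add]; ring
        _ ≤ (N + 2) * Real.exp 1 * (Real.exp 1 * (N + 1) * ((N : ℝ) + 1) ^ (N + 1)) := by gcongr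
        _ = (N + 2) * Real.exp 1 * (Real.exp 1 * ((N : ℝ) + 1) ^ (N + 2)) := by ring
        _ ≤ (N + 2) * Real.exp 1 * ((N : ℝ) + 2) ^ (N + 2) := by gcongr
        _ = _ := by ring
  cases N with
  | zero => simp
  | succ N =>
    push_cast
    refine (key N).trans ?_
    have := Real.exp_one_lt_three
    gcongr
    linarith

theorem pow_self_le_factorial_mul_exp (n : ℕ) : (n : ℝ) ^ n ≤ n.factorial * Real.exp n := by
  have := Real.pow_div_factorial_le_exp (n : ℝ) (by positivity) n
  rw [div_le_iff₀ (by positivity)] at this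
  linarith

section
variable {n : ℕ} (σ : Equiv.Perm (Fin n))

/-- The labelling of each point `x` by `(f x, f (σ x))`. -/
def edgeLabel (f : Fin n → Bool) (x : Fin n) : Bool × Bool := (f x, f (σ x))

theorem card_edgeLabel_sq_mul_le (hn : 0 < n) (hσ : fixCount σ ≤ 2) (N : Bool × Bool → ℕ)
    (hN : ∑ c, N c = n) :
    ((Finset.univ.filter fun f ↦ fiberCount (edgeLabel σ f) = N).card : ℝ) ^ 2 *
      ∏ c, (N c : ℝ) ^ N c ≤ 4 * (n : ℝ) ^ n := by
  have hn' : (0 : ℝ) < n := by exact_mod_cast hn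
  set A := Finset.univ.filter fun f ↦ fiberCount (edgeLabel σ f) = N with hA
  have h1 := sum_prod_le_sqrt_two_pow σ (fun a b ↦ √(N (a, b) / n)) (fun _ _ ↦ Real.sqrt_nonneg _)
    (by
      have h0 : ∀ a b, √((N (a, b) : ℝ) / n) ^ 2 = N (a, b) / n :=
        fun a b ↦ Real.sq_sqrt (by positivity)
      simp only [h0]
      rw [← Fintype.sum_prod_type' (fun a b ↦ (N (a, b) : ℝ) / n), ← Finset.sum_div]
      rw [div_eq_one_iff_eq hn'.ne']
      exact_mod_cast hN)
  have h2 : ∀ f ∈ A, ∏ x, √((N (f x, f (σ x)) : ℝ) / n) = ∏ c, √((N c : ℝ) / n) ^ N c := by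
    intro f hf
    rw [← (Finset.mem_filter.mp hf).2]
    rw [← Finset.prod_fiberwise_of_maps_to (s := Finset.univ) (t := Finset.univ)
      (g := edgeLabel σ f) (fun _ _ ↦ Finset.mem_univ _)]
    refine Finset.prod_congr rfl fun c _ ↦ ?_
    refine (Finset.prod_congr rfl fun x hx ↦ ?_).trans (Finset.prod_const _)
    have hx' : (f x, f (σ x)) = c := (Finset.mem_filter.mp hx).2
    rw [hx']
  have h3 : √2 ^ (Finset.univ.filter fun x ↦ σ x = x).card ≤ 2 := by
    refine (pow_le_pow_right₀ ?_ hσ).trans ?_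
    · exact Real.one_le_sqrt.mpr (by norm_num)
    · simp
  have h4 : (A.card : ℝ) * ∏ c, √((N c : ℝ) / n) ^ N c ≤ 2 := by
    refine le_trans (le_of_eq ?_) ((Finset.sum_le_univ_sum_of_nonneg (s := A)
      (fun f ↦ Finset.prod_nonneg fun _ _ ↦ Real.sqrt_nonneg _)).trans (h1.trans h3))
    rw [Finset.sum_congr rfl h2, Finset.sum_const, nsmul_eq_mul]
  have h5 : ((A.card : ℝ) * ∏ c, √((N c : ℝ) / n) ^ N c) ^ 2 ≤ 2 ^ 2 :=
    pow_le_pow_left₀ (mul_nonneg (by positivity)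
      (Finset.prod_nonneg fun _ _ ↦ pow_nonneg (Real.sqrt_nonneg _) _)) h4 2
  have h6 : (∏ c, √((N c : ℝ) / n) ^ N c) ^ 2 = (∏ c, (N c : ℝ) ^ N c) / (n : ℝ) ^ n := by
    rw [← Finset.prod_pow]
    have : ∀ c, (√((N c : ℝ) / n) ^ N c) ^ 2 = (N c : ℝ) ^ N c / (n : ℝ) ^ N c := by
      intro c
      rw [← pow_mul, mul_comm, pow_mul, Real.sq_sqrt (by positivity), div_pow]
    simp only [this, Finset.prod_div_distrib]
    rw [Finset.prod_pow_eq_pow_sum, hN]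
  rw [mul_pow, h6, mul_div_assoc', div_le_iff₀ (by positivity)] at h5
  linarith

theorem card_edgeLabel_sq_mul_factorial_le (hn : 0 < n) (hσ : fixCount σ ≤ 2)
    (N : Bool × Bool → ℕ) (hN : ∑ c, N c = n) :
    ((Finset.univ.filter fun f ↦ fiberCount (edgeLabel σ f) = N).card : ℝ) ^ 2 *
      ∏ c, ((N c).factorial : ℝ) ≤ 324 * ((n : ℝ) + 1) ^ 4 * n.factorial := by
  have h1 := card_edgeLabel_sq_mul_le σ hn hσ N hN
  set A := ((Finset.univ.filter fun f ↦ fiberCount (edgeLabel σ f) = N).card : ℝ)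
  have h2 : (∏ c, ((N c).factorial : ℝ)) * Real.exp n ≤
      (3 * ((n : ℝ) + 1)) ^ 4 * ∏ c, (N c : ℝ) ^ N c := by
    have : Real.exp n = ∏ c, Real.exp (N c) := by
      rw [← Real.exp_sum]
      congr 1
      exact_mod_cast hN.symm
    rw [this, ← Finset.prod_mul_distrib]
    calc _ ≤ ∏ c, (3 * ((n : ℝ) + 1)) * (N c : ℝ) ^ N c := by
          refine Finset.prod_le_prod (fun c _ ↦ by positivity) fun c _ ↦ ?_
          refine (factorial_mul_exp_le (N c)).trans ?_
          have : N c ≤ n := hN ▸ Finset.single_le_sum (fun _ _ ↦ Nat.zero_le _)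
            (Finset.mem_univ c)
          gcongr
      _ = _ := by
          rw [Finset.prod_mul_distrib, Finset.prod_const]
          simp
  have h3 := pow_self_le_factorial_mul_exp n
  refine le_of_mul_le_mul_right ?_ (Real.exp_pos n)
  calc _ = A ^ 2 * ((∏ c, ((N c).factorial : ℝ)) * Real.exp n) := by ring
    _ ≤ A ^ 2 * ((3 * ((n : ℝ) + 1)) ^ 4 * ∏ c, (N c : ℝ) ^ N c) := by gcongr
    _ = (3 * ((n : ℝ) + 1)) ^ 4 * (A ^ 2 * ∏ c, (N c : ℝ) ^ N c) := by ring
    _ ≤ (3 * ((n : ℝ) + 1)) ^ 4 * (4 * (n.factorial * Real.exp n)) := by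
      refine mul_le_mul_of_nonneg_left (h1.trans ?_) (by positivity)
      gcongr
    _ = _ := by ring

theorem sum_card_invariant_colorings_le (hn : 0 < n) (hσ : fixCount σ ≤ 2) :
    (∑ g : Equiv.Perm (Fin n), ((Finset.univ.filter fun f : Fin n → Bool ↦
      f ∘ (g * σ * g⁻¹ * σ⁻¹ : Equiv.Perm (Fin n)) = f).card : ℝ)) ≤
      324 * ((n : ℝ) + 1) ^ 8 * n.factorial := by
  let ty : (Fin n → Bool) → Bool × Bool → ℕ := fun f ↦ fiberCount (edgeLabel σ f)
  let A : (Bool × Bool → ℕ) → ℕ := fun N ↦ (Finset.univ.filter fun f ↦ ty f = N).card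
  have h1 : ∑ g : Equiv.Perm (Fin n), (Finset.univ.filter fun f : Fin n → Bool ↦
      f ∘ (g * σ * g⁻¹ * σ⁻¹ : Equiv.Perm (Fin n)) = f).card ≤
      ∑ k, A (ty k) * ∏ c, (ty k c).factorial := by
    calc _ ≤ ∑ g : Equiv.Perm (Fin n), ∑ f : Fin n → Bool, ∑ k : Fin n → Bool,
          if edgeLabel σ f ∘ g = edgeLabel σ k then 1 else 0 := by
          refine Finset.sum_le_sum fun g _ ↦ ?_
          rw [Finset.card_filter]
          refine Finset.sum_le_sum fun f _ ↦ ?_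
          split_ifs with h
          · refine le_trans (le_of_eq ?_) (Finset.single_le_sum
              (f := fun k : Fin n → Bool ↦ if edgeLabel σ f ∘ g = edgeLabel σ k then 1 else 0)
              (fun _ _ ↦ Nat.zero_le _) (Finset.mem_univ (f ∘ g)))
            symm
            refine if_pos ?_
            ext x
            · rfl
            · have := congrFun h (σ (g x))
              simp only [edgeLabel, Function.comp_apply]
              rw [← this]
              simp
          · exact Nat.zero_le _
      _ = ∑ k : Fin n → Bool, ∑ f : Fin n → Bool,
          (Finset.univ.filter fun g : Equiv.Perm (Fin n) ↦
            edgeLabel σ f ∘ g = edgeLabel σ k).card := by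
          rw [Finset.sum_comm, Finset.sum_congr rfl fun f _ ↦ Finset.sum_comm, Finset.sum_comm]
          simp only [Finset.card_filter]
      _ ≤ ∑ k : Fin n → Bool, ∑ f : Fin n → Bool,
          if ty f = ty k then ∏ c, (ty k c).factorial else 0 :=
          Finset.sum_le_sum fun k _ ↦ Finset.sum_le_sum fun f _ ↦
            card_perm_comp_eq_le_prod_factorial _ _
      _ = _ := by
          refine Finset.sum_congr rfl fun k _ ↦ ?_
          rw [← Finset.sum_filter, Finset.sum_const, smul_eq_mul]
  let P : Finset (Bool × Bool → ℕ) := Fintype.piFinset fun _ ↦ Finset.range (n + 1)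
  have hty : ∀ k, ∑ c, ty k c = n := fun k ↦ (sum_fiberCount _).trans (by simp)
  have hP : ∀ k ∈ (Finset.univ : Finset (Fin n → Bool)), ty k ∈ P := by
    intro k _
    rw [Fintype.mem_piFinset]
    intro c
    rw [Finset.mem_range, Nat.lt_succ_iff, ← hty k]
    exact Finset.single_le_sum (f := ty k) (fun _ _ ↦ Nat.zero_le _) (Finset.mem_univ c)
  have h2 : (∑ k, (A (ty k) : ℝ) * ∏ c, ((ty k c).factorial : ℝ)) ≤
      324 * ((n : ℝ) + 1) ^ 8 * n.factorial := by
    rw [← Finset.sum_fiberwise_of_maps_to hP]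
    calc _ ≤ ∑ N ∈ P, 324 * ((n : ℝ) + 1) ^ 4 * n.factorial := by
          refine Finset.sum_le_sum fun N _ ↦ ?_
          rw [Finset.sum_congr rfl (g := fun _ ↦ (A N : ℝ) * ∏ c, ((N c).factorial : ℝ))
            (fun k hk ↦ by rw [(Finset.mem_filter.mp hk).2]), Finset.sum_const, nsmul_eq_mul]
          by_cases hN : ∑ c, N c = n
          · refine le_trans (le_of_eq ?_) (card_edgeLabel_sq_mul_factorial_le σ hn hσ N hN)
            simp only [A, ty]
            ring
          · have : (Finset.univ.filter fun k ↦ ty k = N) = ∅ := by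
              rw [Finset.filter_eq_empty_iff]
              rintro k - rfl
              exact hN (hty k)
            rw [this]
            simp only [Finset.card_empty, Nat.cast_zero, zero_mul]
            positivity
      _ = _ := by
          rw [Finset.sum_const, Fintype.card_piFinset]
          simp
          ring
  refine le_trans ?_ h2
  exact_mod_cast h1

end

/-- The number of orbits of a permutation. -/
noncomputable def orbitCount {α : Type} [Finite α] (τ : Equiv.Perm α) : ℕ :=
  Nat.card (Quotient (Equiv.Perm.SameCycle.setoid τ))

section
variable {n : ℕ}

theorem two_pow_orbitCount_le (τ : Equiv.Perm (Fin n)) :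
    2 ^ orbitCount τ ≤ (Finset.univ.filter fun f : Fin n → Bool ↦ f ∘ τ = f).card := by
  classical
  let Q := Quotient (Equiv.Perm.SameCycle.setoid τ)
  have : Fintype Q := Fintype.ofFinite Q
  have h1 : 2 ^ orbitCount τ = (Finset.univ : Finset (Q → Bool)).card := by
    rw [Finset.card_univ, Fintype.card_fun, Fintype.card_bool, orbitCount, Nat.card_eq_fintype_card]
  rw [h1]
  refine Finset.card_le_card_of_injOn (fun f x ↦ f (Quotient.mk _ x)) ?_ ?_
  · intro f _
    rw [Finset.mem_coe, Finset.mem_filter_univ]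
    ext x
    exact congrArg f (Quotient.sound (Equiv.Perm.sameCycle_apply_left.mpr
      (Equiv.Perm.SameCycle.refl τ x)))
  · intro f _ f' _ h
    ext q
    obtain ⟨x, rfl⟩ := Quotient.exists_rep q
    exact congrFun h x

theorem card_centralizer_le_pow_orbitCount (τ : Equiv.Perm (Fin n)) :
    (Finset.univ.filter fun g : Equiv.Perm (Fin n) ↦ g * τ = τ * g).card ≤ n ^ orbitCount τ := by
  classical
  let Q := Quotient (Equiv.Perm.SameCycle.setoid τ)
  have : Fintype Q := Fintype.ofFinite Q
  have h1 : n ^ orbitCount τ = (Finset.univ : Finset (Q → Fin n)).card := by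
    rw [Finset.card_univ, Fintype.card_fun, Fintype.card_fin, orbitCount, Nat.card_eq_fintype_card]
  rw [h1]
  refine Finset.card_le_card_of_injOn (fun g q ↦ g q.out) (fun _ _ ↦ Finset.mem_univ _) ?_
  intro g hg g' hg' h
  rw [Finset.mem_coe, Finset.mem_filter_univ] at hg hg'
  ext x
  obtain ⟨i, hi⟩ : Equiv.Perm.SameCycle τ (Quotient.mk (Equiv.Perm.SameCycle.setoid τ) x).out x :=
    @Quotient.exact _ (Equiv.Perm.SameCycle.setoid τ) _ _ (Quotient.out_eq _)
  have h2 := congrFun h (Quotient.mk _ x)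
  have e1 : g * τ ^ i = τ ^ i * g := (Commute.zpow_right hg i)
  have e2 : g' * τ ^ i = τ ^ i * g' := (Commute.zpow_right hg' i)
  rw [← hi, ← Equiv.Perm.mul_apply, ← Equiv.Perm.mul_apply, e1, e2, Equiv.Perm.mul_apply,
    Equiv.Perm.mul_apply]
  simp only at h2
  rw [h2]

variable {V : Type} [AddCommGroup V] [Module ℂ V] {ρ : Representation ℂ (Equiv.Perm (Fin n)) V}
  {lam : Equiv.Perm (Fin n) → ℂ}

theorem IsScalarIrr.lam_inv (h : IsScalarIrr ρ lam) (σ : Equiv.Perm (Fin n)) :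
    lam σ⁻¹ = lam σ := by
  have : IsConj σ σ⁻¹ := by
    rw [Equiv.Perm.isConj_iff_cycleType_eq, Equiv.Perm.cycleType_inv]
  obtain ⟨k, hk⟩ := isConj_iff.mp this
  rw [← hk, h.lam_conj]

theorem IsScalarIrr.norm_lam_le_orbitCount [FiniteDimensional ℂ V] (h : IsScalarIrr ρ lam)
    (hn : 0 < n) (τ : Equiv.Perm (Fin n)) (T : ℕ) :
    ‖lam τ‖ ≤ 2 ^ orbitCount τ / 2 ^ T + √((n : ℝ) ^ T / Module.finrank ℂ V) := by
  have hd : 0 < Module.finrank ℂ V := by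
    have := h.nontrivial
    exact Module.finrank_pos
  rcases le_or_gt T (orbitCount τ) with hT | hT
  · have h1 : (1 : ℝ) ≤ 2 ^ orbitCount τ / 2 ^ T := by
      rw [one_le_div (by positivity)]
      exact pow_le_pow_right₀ (by norm_num) hT
    have := h.norm_lam_le_one τ
    have := Real.sqrt_nonneg ((n : ℝ) ^ T / Module.finrank ℂ V)
    linarith
  · have h1 := h.finrank_mul_sq_le_centralizer τ
    have h2 : ((Finset.univ.filter fun g : Equiv.Perm (Fin n) ↦ g * τ = τ * g).card : ℝ) ≤
        (n : ℝ) ^ orbitCount τ := by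
      exact_mod_cast card_centralizer_le_pow_orbitCount τ
    have h3 : (n : ℝ) ^ orbitCount τ ≤ (n : ℝ) ^ T :=
      pow_le_pow_right₀ (by exact_mod_cast hn) hT.le
    have h4 : ‖lam τ‖ ≤ √((n : ℝ) ^ T / Module.finrank ℂ V) := by
      apply Real.le_sqrt_of_sq_le
      rw [le_div_iff₀ (by exact_mod_cast hd)]
      linarith
    have : (0 : ℝ) ≤ 2 ^ orbitCount τ / 2 ^ T := by positivity
    linarith

theorem IsScalarIrr.norm_lam_sq_le [FiniteDimensional ℂ V] (h : IsScalarIrr ρ lam)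
    (hn : 0 < n) {σ : Equiv.Perm (Fin n)} (hσ : fixCount σ ≤ 2) (T : ℕ) :
    ‖lam σ‖ ^ 2 ≤ 324 * ((n : ℝ) + 1) ^ 8 / 2 ^ T + √((n : ℝ) ^ T / Module.finrank ℂ V) := by
  have h1 := congrArg norm (h.lam_mul_lam σ σ⁻¹)
  rw [h.lam_inv, norm_mul, norm_mul, Complex.norm_natCast, Fintype.card_perm, Fintype.card_fin,
    ← sq] at h1
  have h2 : (n.factorial : ℝ) * ‖lam σ‖ ^ 2 ≤ n.factorial *
      (324 * ((n : ℝ) + 1) ^ 8 / 2 ^ T + √((n : ℝ) ^ T / Module.finrank ℂ V)) := by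
    rw [h1]
    calc _ ≤ ∑ g : Equiv.Perm (Fin n), ‖lam (g * σ * g⁻¹ * σ⁻¹)‖ := norm_sum_le _ _
      _ ≤ ∑ g : Equiv.Perm (Fin n), (((Finset.univ.filter fun f : Fin n → Bool ↦
          f ∘ (g * σ * g⁻¹ * σ⁻¹ : Equiv.Perm (Fin n)) = f).card : ℝ) / 2 ^ T +
          √((n : ℝ) ^ T / Module.finrank ℂ V)) := by
        refine Finset.sum_le_sum fun g _ ↦ (h.norm_lam_le_orbitCount hn _ T).trans ?_
        gcongr
        exact_mod_cast two_pow_orbitCount_le (g * σ * g⁻¹ * σ⁻¹)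
      _ ≤ (324 * ((n : ℝ) + 1) ^ 8 * n.factorial) / 2 ^ T +
          n.factorial * √((n : ℝ) ^ T / Module.finrank ℂ V) := by
        rw [Finset.sum_add_distrib, ← Finset.sum_div]
        refine add_le_add ?_ ?_
        · gcongr
          exact sum_card_invariant_colorings_le σ hn hσ
        · simp [Fintype.card_perm]
      _ = _ := by ring
  exact le_of_mul_le_mul_left h2 (by positivity)

end

section
variable {n : ℕ} {V : Type} [AddCommGroup V] [Module ℂ V]

/-- `u` is a nonzero vector on which the transposition of each of the disjoint pairs
`e (i, false), e (i, true)` acts by `-1` if `i ∈ A` and by `1` otherwise. -/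
structure IsWeightVector (ρ : Representation ℂ (Equiv.Perm (Fin n)) V) {ι : Type}
    (e : ι × Bool → Fin n) (A : Finset ι) (u : V) : Prop where
  inj : Function.Injective e
  ne_zero : u ≠ 0
  minus : ∀ i ∈ A, ρ (Equiv.swap (e (i, false)) (e (i, true))) u = -u
  plus : ∀ i ∉ A, ρ (Equiv.swap (e (i, false)) (e (i, true))) u = u

/-- There is a weight vector for `p + q` disjoint transpositions, of which `p` act by `-1`. -/
def HasWeight (ρ : Representation ℂ (Equiv.Perm (Fin n)) V) (p q : ℕ) : Prop :=
  ∃ (ι : Type) (_ : Fintype ι) (e : ι × Bool → Fin n) (A : Finset ι) (u : V),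
    IsWeightVector ρ e A u ∧ A.card = p ∧ Fintype.card ι = p + q

variable {ρ : Representation ℂ (Equiv.Perm (Fin n)) V}

theorem HasWeight.of_le {ι : Type} [Fintype ι] {e : ι × Bool → Fin n} {A : Finset ι}
    {u : V} (h : IsWeightVector ρ e A u) {p q : ℕ} (hp : p ≤ A.card)
    (hq : q + A.card ≤ Fintype.card ι) : HasWeight ρ p q := by
  classical
  obtain ⟨B, hBA, hB⟩ := Finset.exists_subset_card_eq hp
  obtain ⟨C, hCA, hC⟩ := Finset.exists_subset_card_eq (s := Aᶜ) (n := q)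
    (by rw [Finset.card_compl]; omega)
  have hdisj : Disjoint B C :=
    Finset.disjoint_of_subset_left hBA
      (Finset.disjoint_of_subset_right hCA disjoint_compl_right)
  refine ⟨{i // i ∈ B ∪ C}, inferInstance, fun x ↦ e (x.1.1, x.2),
    Finset.univ.filter fun i ↦ i.1 ∈ B, u, ⟨?_, h.ne_zero, ?_, ?_⟩, ?_, ?_⟩
  · rintro ⟨⟨i, hi⟩, a⟩ ⟨⟨j, hj⟩, b⟩ hij
    have := h.inj hij
    simp_all
  · intro i hi
    exact h.minus _ (hBA (Finset.mem_filter.mp hi).2)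
  · intro i hi
    have h1 : i.1 ∉ B := fun h' ↦ hi (by simpa using h')
    have h2 : i.1 ∈ C := (Finset.mem_union.mp i.2).resolve_left h1
    exact h.plus _ (by simpa using hCA h2)
  · rw [← hB]
    refine Finset.card_bij (fun i _ ↦ i.1) ?_ ?_ ?_
    · intro i hi
      exact (Finset.mem_filter.mp hi).2
    · intro i _ j _ hij
      exact Subtype.ext hij
    · intro b hb
      exact ⟨⟨b, Finset.mem_union_left _ hb⟩, by simpa using hb, rfl⟩
  · rw [Fintype.card_coe, Finset.card_union_of_disjoint hdisj, hB, hC]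

theorem HasWeight.zero [Nontrivial V] : HasWeight ρ 0 0 := by
  obtain ⟨v, hv⟩ := exists_ne (0 : V)
  exact ⟨Empty, inferInstance, fun x ↦ x.1.elim, ∅, v,
    ⟨fun x ↦ x.1.elim, hv, fun i ↦ i.elim, fun i ↦ i.elim⟩, rfl, rfl⟩

theorem swap_commute_of_ne {a b x y : Fin n} (h1 : a ≠ x) (h2 : a ≠ y) (h3 : b ≠ x)
    (h4 : b ≠ y) : Equiv.swap x y * Equiv.swap a b = Equiv.swap a b * Equiv.swap x y := by
  have := Equiv.swap_apply_apply (Equiv.swap a b) x y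
  rw [Equiv.swap_apply_of_ne_of_ne h1.symm h3.symm, Equiv.swap_apply_of_ne_of_ne h2.symm h4.symm]
    at this
  nth_rewrite 1 [this]
  simp

/-- Adjoining a transposition `(a b)` acting by `-1` or `1` to a weight vector. -/
theorem IsWeightVector.adjoin_minus {ι : Type} {e : ι × Bool → Fin n}
    {A : Finset ι} {u : V} (h : IsWeightVector ρ e A u) {a b : Fin n} (hab : a ≠ b)
    (ha : ∀ x, e x ≠ a) (hb : ∀ x, e x ≠ b) (hu : ρ (Equiv.swap a b) u = -u) :
    IsWeightVector ρ (fun x : Option ι × Bool ↦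
      x.1.elim (if x.2 then b else a) fun i ↦ e (i, x.2)) A.insertNone u := by
  refine ⟨?_, h.ne_zero, ?_, ?_⟩
  · rintro ⟨i | i, c⟩ ⟨j | j, d⟩ hij
    · cases c <;> cases d <;> simp_all
    · cases c
      · exact absurd hij.symm (ha _)
      · exact absurd hij.symm (hb _)
    · cases d
      · exact absurd hij (ha _)
      · exact absurd hij (hb _)
    · have := h.inj hij
      simp_all
  · rintro (_ | i) hi
    · simpa using hu
    · exact h.minus i (by simpa using hi)
  · rintro (_ | i) hi
    · simp at hi
    · exact h.plus i (by simpa using hi)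

theorem IsWeightVector.adjoin_plus {ι : Type} {e : ι × Bool → Fin n}
    {A : Finset ι} {u : V} (h : IsWeightVector ρ e A u) {a b : Fin n} (hab : a ≠ b)
    (ha : ∀ x, e x ≠ a) (hb : ∀ x, e x ≠ b) (hu : ρ (Equiv.swap a b) u = u) :
    IsWeightVector ρ (fun x : Option ι × Bool ↦
      x.1.elim (if x.2 then b else a) fun i ↦ e (i, x.2)) (A.map Function.Embedding.some) u := by
  refine ⟨?_, h.ne_zero, ?_, ?_⟩
  · rintro ⟨i | i, c⟩ ⟨j | j, d⟩ hij
    · cases c <;> cases d <;> simp_all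
    · cases c
      · exact absurd hij.symm (ha _)
      · exact absurd hij.symm (hb _)
    · cases d
      · exact absurd hij (ha _)
      · exact absurd hij (hb _)
    · have := h.inj hij
      simp_all
  · rintro (_ | i) hi
    · simp at hi
    · exact h.minus i (by simpa using hi)
  · rintro (_ | i) hi
    · simpa using hu
    · exact h.plus i (by simpa using hi)

theorem swap_apply_swap_apply (a b : Fin n) (u : V) :
    ρ (Equiv.swap a b) (ρ (Equiv.swap a b) u) = u := by
  rw [← Module.End.mul_apply, ← map_mul, Equiv.swap_mul_self, map_one, Module.End.one_apply]

theorem swap_apply_comm {a b x y : Fin n} (h1 : a ≠ x) (h2 : a ≠ y) (h3 : b ≠ x)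
    (h4 : b ≠ y) (u : V) : ρ (Equiv.swap x y) (ρ (Equiv.swap a b) u) =
      ρ (Equiv.swap a b) (ρ (Equiv.swap x y) u) := by
  rw [← Module.End.mul_apply, ← map_mul, swap_commute_of_ne h1 h2 h3 h4, map_mul,
    Module.End.mul_apply]

theorem HasWeight.extend {p q : ℕ} (h : HasWeight ρ p q) (hn : 2 * (p + q) + 2 ≤ n) :
    HasWeight ρ (p + 1) q ∨ HasWeight ρ p (q + 1) := by
  classical
  obtain ⟨ι, _, e, A, u, hu, hA, hc⟩ := h
  have hR : 1 < (Finset.univ.image e)ᶜ.card := by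
    rw [Finset.card_compl, Finset.card_image_of_injective _ hu.inj]
    simp [hc]
    omega
  obtain ⟨a, ha, b, hb, hab⟩ := Finset.one_lt_card.mp hR
  have ha' : ∀ x, e x ≠ a := by simpa using ha
  have hb' : ∀ x, e x ≠ b := by simpa using hb
  have hcomm : ∀ i, ρ (Equiv.swap (e (i, false)) (e (i, true))) (ρ (Equiv.swap a b) u) =
      ρ (Equiv.swap a b) (ρ (Equiv.swap (e (i, false)) (e (i, true))) u) := fun i ↦
    swap_apply_comm (ha' _).symm (ha' _).symm (hb' _).symm (hb' _).symm u
  by_cases h0 : u - ρ (Equiv.swap a b) u = 0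
  · right
    rw [sub_eq_zero] at h0
    exact HasWeight.of_le (hu.adjoin_plus hab ha' hb' h0.symm) (by simp [hA])
      (by simp [hA, hc]; omega)
  · left
    have hu' : IsWeightVector ρ e A (u - ρ (Equiv.swap a b) u) := by
      refine ⟨hu.inj, h0, fun i hi ↦ ?_, fun i hi ↦ ?_⟩
      · rw [map_sub, hcomm, hu.minus i hi, map_neg]; abel
      · rw [map_sub, hcomm, hu.plus i hi]
    refine HasWeight.of_le (hu'.adjoin_minus hab ha' hb' ?_) (by simp [hA])
      (by simp [hA, hc]; omega)
    rw [map_sub, swap_apply_swap_apply, neg_sub]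

theorem exists_perm_image_eq {ι : Type} [Fintype ι] [DecidableEq ι] {A B : Finset ι}
    (h : A.card = B.card) : ∃ π : Equiv.Perm ι, ∀ i, π i ∈ B ↔ i ∈ A := by
  let e : {i // i ∈ A} ≃ {i // i ∈ B} := Finset.equivOfCardEq h
  exact ⟨e.extendSubtype, fun i ↦ ⟨fun hi ↦ by
    by_contra hA
    exact e.extendSubtype_not_mem i hA hi, e.extendSubtype_mem i⟩⟩

theorem IsWeightVector.exists_of_card_eq {ι : Type} [Fintype ι] {e : ι × Bool → Fin n}
    {A B : Finset ι} {u : V} (h : IsWeightVector ρ e A u) (hAB : A.card = B.card) :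
    ∃ w, IsWeightVector ρ e B w := by
  classical
  obtain ⟨π, hπ⟩ := exists_perm_image_eq hAB
  let g : Equiv.Perm (Fin n) :=
    Equiv.Perm.viaEmbedding (π.prodCongr (Equiv.refl Bool)) ⟨e, h.inj⟩
  have hg : ∀ i b, g (e (i, b)) = e (π i, b) := fun i b ↦
    Equiv.Perm.viaEmbedding_apply (π.prodCongr (Equiv.refl Bool)) ⟨e, h.inj⟩ (i, b)
  have hconj : ∀ i, ρ (Equiv.swap (e (π i, false)) (e (π i, true))) (ρ g u) =
      ρ g (ρ (Equiv.swap (e (i, false)) (e (i, true))) u) := by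
    intro i
    rw [← hg, ← hg, Equiv.swap_apply_apply, ← Module.End.mul_apply, ← Module.End.mul_apply,
      ← map_mul, ← map_mul]
    simp
  refine ⟨ρ g u, h.inj, ?_, fun i hi ↦ ?_, fun i hi ↦ ?_⟩
  · intro h0
    apply h.ne_zero
    have : ρ g⁻¹ (ρ g u) = u := by
      rw [← Module.End.mul_apply, ← map_mul]; simp
    rw [← this, h0, map_zero]
  · obtain ⟨j, rfl⟩ := π.surjective i
    rw [hconj, h.minus j ((hπ j).mp hi), map_neg]
  · obtain ⟨j, rfl⟩ := π.surjective i
    rw [hconj, h.plus j (fun hj ↦ hi ((hπ j).mpr hj))]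

theorem HasWeight.choose_le_finrank [FiniteDimensional ℂ V] {p q : ℕ} (h : HasWeight ρ p q) :
    (p + q).choose p ≤ Module.finrank ℂ V := by
  classical
  obtain ⟨ι, _, e, A, u, hu, hA, hc⟩ := h
  let f := Fintype.equivFin ι
  let P := {B : Finset ι // B ∈ Finset.univ.powersetCard p}
  have hP : ∀ B : P, B.1.card = A.card := fun B ↦ by
    rw [hA]; exact (Finset.mem_powersetCard.mp B.2).2
  choose w hw using fun B : P ↦ hu.exists_of_card_eq (hP B).symm
  let T : Module.End ℂ V := ∑ i, ((2 : ℂ) ^ (f i : ℕ) / 2) •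
    (1 - ρ (Equiv.swap (e (i, false)) (e (i, true))))
  let μ : P → ℂ := fun B ↦ ∑ i ∈ B.1, (2 : ℂ) ^ (f i : ℕ)
  have hμ : Function.Injective μ := by
    intro B C hBC
    have h1 : ∑ i ∈ B.1, 2 ^ (f i : ℕ) = ∑ i ∈ C.1, 2 ^ (f i : ℕ) := by
      simp only [μ] at hBC
      exact_mod_cast hBC
    let F : ι ↪ ℕ := ⟨fun i ↦ (f i : ℕ), Fin.val_injective.comp f.injective⟩
    have h2 : B.1.map F = C.1.map F := by
      apply Finset.geomSum_injective le_rfl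
      simpa [F] using h1
    exact Subtype.ext (Finset.map_injective F h2)
  have hT : ∀ B, T.HasEigenvector (μ B) (w B) := by
    intro B
    rw [Module.End.hasEigenvector_iff, Module.End.mem_eigenspace_iff]
    refine ⟨?_, (hw B).ne_zero⟩
    simp only [T, μ, LinearMap.sum_apply, LinearMap.smul_apply, LinearMap.sub_apply,
      Module.End.one_apply]
    rw [← Finset.sum_subset (Finset.subset_univ B.1), Finset.sum_smul]
    · refine Finset.sum_congr rfl fun i hi ↦ ?_
      rw [(hw B).minus i hi, sub_neg_eq_add, ← two_smul ℂ (w B), smul_smul]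
      congr 1
      ring
    · intro i _ hi
      rw [(hw B).plus i hi, sub_self, smul_zero]
  have h1 := (Module.End.eigenvectors_linearIndependent' T μ hμ w hT).fintype_card_le_finrank
  refine le_trans (le_of_eq ?_) h1
  rw [Fintype.card_coe, Finset.card_powersetCard, Finset.card_univ, hc]

end

section
variable {n : ℕ} {V : Type} [AddCommGroup V] [Module ℂ V]

/-- The vector `v` is invariant under the pointwise stabilizer of `S`. -/
def FixedOff (ρ : Representation ℂ (Equiv.Perm (Fin n)) V) (S : Finset (Fin n)) (v : V) : Prop :=
  ∀ g : Equiv.Perm (Fin n), (∀ x ∈ S, g x = x) → ρ g v = v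

variable {ρ : Representation ℂ (Equiv.Perm (Fin n)) V}

theorem fixedOff_of_swap {S : Finset (Fin n)} {v : V}
    (h : ∀ a ∉ S, ∀ b ∉ S, ρ (Equiv.swap a b) v = v) : FixedOff ρ S v := by
  intro g
  induction hk : g.support.card using Nat.strong_induction_on generalizing g with
  | _ k ih =>
    intro hg
    by_cases h1 : g = 1
    · rw [h1, map_one, Module.End.one_apply]
    · obtain ⟨x, hx⟩ : ∃ x, g x ≠ x := by
        by_contra! hcon
        exact h1 (Equiv.ext hcon)
      have hxS : x ∉ S := fun hxS ↦ hx (hg x hxS)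
      have hgS : g x ∉ S := fun hgS ↦ hx (g.injective (hg _ hgS))
      have hlt := Equiv.Perm.card_support_swap_mul hx
      have h2 := ih _ (hk ▸ hlt) _ rfl (fun y hy ↦ by
        rw [Equiv.Perm.mul_apply, hg y hy]
        exact Equiv.swap_apply_of_ne_of_ne (fun h' ↦ hxS (h' ▸ hy)) fun h' ↦ hgS (h' ▸ hy))
      rw [map_mul, Module.End.mul_apply] at h2
      have h3 := congrArg (ρ (Equiv.swap x (g x))) h2
      rwa [swap_apply_swap_apply, h x hxS _ hgS] at h3

theorem IsWeightVector.restrict {ι : Type} [DecidableEq ι] {e : ι × Bool → Fin n}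
    {A J : Finset ι} {u : V} (h : IsWeightVector ρ e A u) :
    IsWeightVector ρ (fun x : {i // i ∈ J} × Bool ↦ e (x.1.1, x.2))
      (Finset.univ.filter fun i ↦ i.1 ∈ A) u := by
  refine ⟨?_, h.ne_zero, fun i hi ↦ ?_, fun i hi ↦ ?_⟩
  · rintro ⟨⟨i, hi⟩, a⟩ ⟨⟨j, hj⟩, b⟩ hij
    have := h.inj hij
    simp_all
  · exact h.minus _ (by simpa using hi)
  · exact h.plus _ (by simpa using hi)

theorem IsWeightVector.swap_apply_eq {ι : Type} [Fintype ι] {e : ι × Bool → Fin n}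
    {A : Finset ι} {u : V} (h : IsWeightVector ρ e A u) {q : ℕ}
    (hq : q + A.card + 2 ≤ Fintype.card ι) (hno : ¬ HasWeight ρ (A.card + 1) q)
    {a b : Fin n} (ha : ∀ i ∈ A, ∀ c, e (i, c) ≠ a) (hb : ∀ i ∈ A, ∀ c, e (i, c) ≠ b) :
    ρ (Equiv.swap a b) u = u := by
  classical
  by_contra hne
  apply hno
  have hab : a ≠ b := by
    rintro rfl
    apply hne
    rw [Equiv.swap_self]
    exact congrFun (congrArg DFunLike.coe (map_one ρ)) u
  let B : Finset ι := Finset.univ.filter fun i ↦ ∃ c, e (i, c) = a ∨ e (i, c) = b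
  have hB : B.card ≤ 2 := by
    have h1 : B ⊆ (({a, b} : Finset (Fin n)).preimage e h.inj.injOn).image Prod.fst := by
      intro i hi
      obtain ⟨c, hc⟩ := (Finset.mem_filter.mp hi).2
      exact Finset.mem_image.mpr ⟨(i, c), by simpa using hc, rfl⟩
    refine (Finset.card_le_card h1).trans (Finset.card_image_le.trans ?_)
    refine le_trans ?_ (Finset.card_le_two (a := a) (b := b))
    rw [← Finset.card_map ⟨e, h.inj⟩]
    exact Finset.card_le_card fun x hx ↦ by
      obtain ⟨y, hy, rfl⟩ := Finset.mem_map.mp hx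
      exact Finset.mem_preimage.mp hy
  have hAB : A ⊆ Bᶜ := by
    intro i hi
    simp only [B, Finset.mem_compl, Finset.mem_filter, Finset.mem_univ, true_and, not_exists]
    intro c hc
    exact hc.elim (ha i hi c) (hb i hi c)
  have hJ : ∀ i ∈ Bᶜ, ∀ c, e (i, c) ≠ a ∧ e (i, c) ≠ b := by
    intro i hi c
    simp only [B, Finset.mem_compl, Finset.mem_filter, Finset.mem_univ, true_and,
      not_exists, not_or] at hi
    exact hi c
  have h2 := h.restrict (J := Bᶜ)
  have hcomm : ∀ i ∈ Bᶜ, ρ (Equiv.swap (e (i, false)) (e (i, true))) (ρ (Equiv.swap a b) u) =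
      ρ (Equiv.swap a b) (ρ (Equiv.swap (e (i, false)) (e (i, true))) u) := fun i hi ↦
    swap_apply_comm (hJ i hi _).1.symm (hJ i hi _).1.symm (hJ i hi _).2.symm
      (hJ i hi _).2.symm u
  have h3 : IsWeightVector ρ (fun x : {i // i ∈ Bᶜ} × Bool ↦ e (x.1.1, x.2))
      (Finset.univ.filter fun i ↦ i.1 ∈ A) (u - ρ (Equiv.swap a b) u) := by
    refine ⟨h2.inj, sub_ne_zero.mpr (Ne.symm hne), fun i hi ↦ ?_, fun i hi ↦ ?_⟩
    · rw [map_sub, hcomm _ i.2, h2.minus i hi, map_neg]; abel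
    · rw [map_sub, hcomm _ i.2, h2.plus i hi]
  have hcard : (Finset.univ.filter fun i : {i // i ∈ Bᶜ} ↦ i.1 ∈ A).card = A.card := by
    refine Finset.card_bij (fun i _ ↦ i.1) ?_ ?_ ?_
    · intro i hi
      exact (Finset.mem_filter.mp hi).2
    · intro i _ j _ hij
      exact Subtype.ext hij
    · intro i hi
      exact ⟨⟨i, hAB hi⟩, by simpa using hi, rfl⟩
  refine HasWeight.of_le (h3.adjoin_minus hab (fun x ↦ (hJ _ x.1.2 _).1)
    (fun x ↦ (hJ _ x.1.2 _).2) ?_) ?_ ?_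
  · rw [map_sub, swap_apply_swap_apply, neg_sub]
  · rw [Finset.card_insertNone, hcard]
  · have h5 : (Bᶜ).card = Fintype.card ι - B.card := Finset.card_compl B
    simp only [Finset.card_insertNone, hcard, Fintype.card_option, Fintype.card_coe]
    omega

/-- A weight vector with no room for a further minus sign is invariant under the pointwise
stabilizer of the points moved by its minus transpositions. -/
theorem HasWeight.exists_fixedOff {p q : ℕ} (h : HasWeight ρ p (q + 2))
    (hno : ¬ HasWeight ρ (p + 1) q) :
    ∃ S : Finset (Fin n), S.card = 2 * p ∧ ∃ v ≠ 0, FixedOff ρ S v := by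
  classical
  obtain ⟨ι, _, e, A, u, hu, hA, hc⟩ := h
  refine ⟨(A ×ˢ Finset.univ).image e, ?_, u, hu.ne_zero, fixedOff_of_swap ?_⟩
  · rw [Finset.card_image_of_injective _ hu.inj, Finset.card_product, hA]
    simp [mul_comm]
  · intro a ha b hb
    refine hu.swap_apply_eq (q := q) (by omega) (by rwa [hA]) ?_ ?_
    · intro i hi c hcon
      exact ha (Finset.mem_image.mpr ⟨(i, c), by simp [hi], hcon⟩)
    · intro i hi c hcon
      exact hb (Finset.mem_image.mpr ⟨(i, c), by simp [hi], hcon⟩)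

/-- If some `(p, m - p)` with `p < K` is a weight but neither `(K, m - K)` nor
`(K + 1, m - K - 1)` is, then for the largest such `p` there is a nonzero vector which is
invariant under the pointwise stabilizer of `2 p` points. -/
theorem HasWeight.exists_maximal {m K : ℕ} (hm : 2 * m ≤ n) (hK : K + 2 ≤ m)
    (h : ∃ p < K, HasWeight ρ p (m - p))
    (hno : ∀ p, K ≤ p → p ≤ K + 1 → ¬ HasWeight ρ p (m - p)) :
    ∃ p < K, HasWeight ρ p (m - p) ∧
      (∀ p', p < p' → p' ≤ K + 1 → ¬ HasWeight ρ p' (m - p')) ∧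
      ∃ S : Finset (Fin n), S.card = 2 * p ∧ ∃ v ≠ 0, FixedOff ρ S v := by
  classical
  obtain ⟨p₀, hp₀, h₀⟩ := h
  let W := (Finset.range K).filter fun p ↦ HasWeight ρ p (m - p)
  have hW : W.Nonempty := ⟨p₀, by simp [W, hp₀, h₀]⟩
  have hmem := W.max'_mem hW
  have hmax : ∀ p', W.max' hW < p' → p' ≤ K + 1 → ¬ HasWeight ρ p' (m - p') := by
    intro p' h1 h2 h3
    by_cases h4 : p' < K
    · have := W.le_max' p' (by simp [W, h4, h3])
      omega
    · exact hno p' (by omega) h2 h3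
  generalize W.max' hW = p at hmem hmax
  simp only [W, Finset.mem_filter, Finset.mem_range] at hmem
  refine ⟨p, hmem.1, hmem.2, hmax, ?_⟩
  have h1 : m - p = (m - p - 2) + 2 := by omega
  refine HasWeight.exists_fixedOff (q := m - p - 2) (h1 ▸ hmem.2) fun hcon ↦ ?_
  rcases hcon.extend (by omega) with h2 | h2
  · exact hmax (p + 2) (by omega) (by omega) (by convert h2 using 1; omega)
  · exact hmax (p + 1) (by omega) (by omega) (by convert h2 using 1; omega)

end

theorem exists_invariant_seminorm {G V : Type} [Group G] [Fintype G] [AddCommGroup V]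
    [Module ℂ V] (ρ : Representation ℂ G V) {v : V} (hv : v ≠ 0) :
    ∃ p : Seminorm ℂ V, (∀ g x, p (ρ g x) = p x) ∧ 0 < p v := by
  obtain ⟨l, hl⟩ : ∃ l : Module.Dual ℂ V, l v ≠ 0 := by
    by_contra! hcon
    exact hv ((Module.forall_dual_apply_eq_zero_iff ℂ v).mp hcon)
  refine ⟨Seminorm.of (fun x ↦ ∑ g, ‖l (ρ g x)‖) (fun x y ↦ ?_) fun a x ↦ ?_, fun g x ↦ ?_, ?_⟩
  · rw [← Finset.sum_add_distrib]
    exact Finset.sum_le_sum fun g _ ↦ by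
      rw [map_add, map_add]
      exact norm_add_le _ _
  · simp [Finset.mul_sum]
  · refine Fintype.sum_equiv (Equiv.mulRight g) _ _ fun k ↦ ?_
    rw [Equiv.coe_mulRight, map_mul, Module.End.mul_apply]
  · refine lt_of_lt_of_le (norm_pos_iff.mpr hl) ?_
    refine le_trans ?_ (Finset.single_le_sum (f := fun g ↦ ‖l (ρ g v)‖)
      (fun _ _ ↦ norm_nonneg _) (Finset.mem_univ 1))
    simp

theorem Seminorm.card_add_one_mul_le {V ι : Type} [AddCommGroup V] [Module ℂ V] [DecidableEq ι]
    (p : Seminorm ℂ V) (T : V →ₗ[ℂ] V) {v : V} {s : ι → V} {R B : Finset ι} (hB : B ⊆ R)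
    (hs : ∑ b ∈ R, s b = -v) {c C : ℝ} (hc : ∀ b ∈ B, p (T (v - s b)) ≤ c)
    (hC : ∀ b ∈ R \ B, p (T (s b)) ≤ C) :
    ((B.card : ℝ) + 1) * p (T v) ≤ B.card * c + (R \ B).card * C := by
  have h1 : ((B.card : ℂ) + 1) • T v =
      ∑ b ∈ B, T (v - s b) - ∑ b ∈ R \ B, T (s b) := by
    have h2 : ∑ b ∈ R \ B, s b = -v - ∑ b ∈ B, s b := by
      rw [← hs, ← Finset.sum_sdiff hB]; abel
    rw [← map_sum, ← map_sum, h2, ← map_sub, Finset.sum_sub_distrib, Finset.sum_const,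
      ← Nat.cast_smul_eq_nsmul ℂ, ← map_smul, add_smul, one_smul]
    congr 1
    abel
  have h3 : p (((B.card : ℂ) + 1) • T v) = ((B.card : ℝ) + 1) * p (T v) := by
    rw [map_smul_eq_mul]
    congr 1
    have : ((B.card : ℂ) + 1) = ((B.card + 1 : ℕ) : ℂ) := by push_cast; rfl
    rw [this, Complex.norm_natCast]
    push_cast; rfl
  rw [← h3, h1]
  refine (map_sub_le_add p _ _).trans (add_le_add ?_ ?_)
  · refine (Finset.le_sum_of_subadditive p (map_zero p).le (map_add_le_add p) _ _).trans ?_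
    refine (Finset.sum_le_card_nsmul _ _ c hc).trans (by simp)
  · refine (Finset.le_sum_of_subadditive p (map_zero p).le (map_add_le_add p) _ _).trans ?_
    refine (Finset.sum_le_card_nsmul _ _ C hC).trans (by simp)

section
variable {n : ℕ} {V : Type} [AddCommGroup V] [Module ℂ V]
  {ρ : Representation ℂ (Equiv.Perm (Fin n)) V}

theorem FixedOff.sum_swap {S : Finset (Fin n)} {v : V} (h : FixedOff ρ S v) {a : Fin n}
    (ha : a ∈ S) : FixedOff ρ (S.erase a) (v + ∑ b ∈ Sᶜ, ρ (Equiv.swap a b) v) := by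
  classical
  have h1 : v + ∑ b ∈ Sᶜ, ρ (Equiv.swap a b) v =
      ∑ b ∈ (S.erase a)ᶜ, ρ (Equiv.swap a b) v := by
    rw [Finset.compl_erase, Finset.sum_insert (by simpa using ha)]
    congr 1
    rw [Equiv.swap_self]
    exact (congrFun (congrArg DFunLike.coe (map_one ρ)) v).symm
  rw [h1]
  intro g hg
  rw [map_sum]
  refine Finset.sum_bij (fun b _ ↦ g b) ?_ ?_ ?_ ?_
  · intro b hb
    rw [Finset.mem_compl] at hb ⊢
    intro hgb
    have := g.injective (hg _ hgb)
    exact hb (this ▸ hgb)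
  · intro b _ c _ hbc
    exact g.injective hbc
  · intro b hb
    refine ⟨g⁻¹ b, ?_, by simp⟩
    rw [Finset.mem_compl] at hb ⊢
    intro hgb
    have := hg _ hgb
    have h2 : g (g⁻¹ b) = b := by simp
    rw [h2] at this
    exact hb (this ▸ hgb)
  · intro b hb
    have hfix : ∀ x ∈ S, (Equiv.swap a (g b) * g * Equiv.swap a b) x = x := by
      intro x hx
      by_cases hxa : x = a
      · subst hxa; simp
      · have hxb : x ≠ b := by
          rintro rfl
          exact (Finset.mem_compl.mp hb) (Finset.mem_erase.mpr ⟨hxa, hx⟩)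
        have hgx := hg x (Finset.mem_erase.mpr ⟨hxa, hx⟩)
        have hxgb : x ≠ g b := fun h' ↦ hxb (g.injective (hgx.trans h'))
        simp only [Equiv.Perm.mul_apply]
        rw [Equiv.swap_apply_of_ne_of_ne hxa hxb, hgx, Equiv.swap_apply_of_ne_of_ne hxa hxgb]
    have h2 := h _ hfix
    rw [mul_assoc, map_mul, Module.End.mul_apply] at h2
    have h3 := congrArg (ρ (Equiv.swap a (g b))) h2
    rw [swap_apply_swap_apply, map_mul, Module.End.mul_apply] at h3
    exact h3

/-- The alternating vector attached to a vector `v` which is fixed off three points is a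
weight vector with three minus signs. -/
theorem FixedOff.hasWeight {S : Finset (Fin n)} {v : V} (h : FixedOff ρ S v)
    {a₁ a₂ a₃ b₁ b₂ b₃ : Fin n} (ha₁ : a₁ ∈ S) (ha₂ : a₂ ∈ S) (ha₃ : a₃ ∈ S)
    (h12 : a₁ ≠ a₂) (h13 : a₁ ≠ a₃) (h23 : a₂ ≠ a₃)
    (hb₁ : b₁ ∉ S) (hb₂ : b₂ ∉ S) (hb₃ : b₃ ∉ S)
    (k12 : b₁ ≠ b₂) (k13 : b₁ ≠ b₃) (k23 : b₂ ≠ b₃)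
    (hz : (1 - ρ (Equiv.swap a₁ b₁)) ((1 - ρ (Equiv.swap a₂ b₂))
      (v - ρ (Equiv.swap a₃ b₃) v)) ≠ 0) {q : ℕ} (hq : 2 * q + S.card + 3 ≤ n) :
    HasWeight ρ 3 q := by
  classical
  set z := (1 - ρ (Equiv.swap a₁ b₁)) ((1 - ρ (Equiv.swap a₂ b₂))
      (v - ρ (Equiv.swap a₃ b₃) v)) with hzdef
  have hne : ∀ a ∈ S, ∀ b ∉ S, a ≠ b := fun a ha b hb hab ↦ hb (hab ▸ ha)
  let R : Finset (Fin n) := (S ∪ {b₁, b₂, b₃})ᶜ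
  have hR : 2 * q ≤ R.card := by
    have h1 : R.card = n - (S ∪ {b₁, b₂, b₃}).card := by
      rw [Finset.card_compl, Fintype.card_fin]
    have h2 : (S ∪ {b₁, b₂, b₃}).card ≤ S.card + 3 :=
      (Finset.card_union_le _ _).trans (by gcongr; exact Finset.card_le_three)
    omega
  obtain ⟨e⟩ : Nonempty (Fin q × Bool ↪ R) := by
    apply Function.Embedding.nonempty_of_card_le
    simpa [mul_comm] using hR
  have hRmem : ∀ x : R, x.1 ∉ S ∧ x.1 ≠ b₁ ∧ x.1 ≠ b₂ ∧ x.1 ≠ b₃ := by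
    intro x
    have := x.2
    simpa [R, not_or] using this
  have hRa : ∀ x : R, ∀ a ∈ S, x.1 ≠ a := fun x a ha ↦ (hne a ha _ (hRmem x).1).symm
  have hcomm : ∀ a b x y : Fin n, a ≠ x → a ≠ y → b ≠ x → b ≠ y → ∀ w : V,
      ρ (Equiv.swap x y) (w - ρ (Equiv.swap a b) w) =
        ρ (Equiv.swap x y) w - ρ (Equiv.swap a b) (ρ (Equiv.swap x y) w) :=
    fun a b x y h1 h2 h3 h4 w ↦ by rw [map_sub, swap_apply_comm h1 h2 h3 h4]
  simp only [LinearMap.sub_apply, Module.End.one_apply] at hzdef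
  have w0 : IsWeightVector ρ (fun x : Fin q × Bool ↦ (e x).1) ∅ z := by
    refine ⟨Subtype.val_injective.comp e.injective, hz, by simp, fun i _ ↦ ?_⟩
    obtain ⟨s1, s2, s3, s4⟩ := hRmem (e (i, false))
    obtain ⟨t1, t2, t3, t4⟩ := hRmem (e (i, true))
    have r := hRa (e (i, false))
    have r' := hRa (e (i, true))
    rw [hzdef, hcomm _ _ _ _ (r _ ha₁).symm (r' _ ha₁).symm s2.symm t2.symm,
      hcomm _ _ _ _ (r _ ha₂).symm (r' _ ha₂).symm s3.symm t3.symm,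
      hcomm _ _ _ _ (r _ ha₃).symm (r' _ ha₃).symm s4.symm t4.symm,
      h _ fun x hx ↦ Equiv.swap_apply_of_ne_of_ne (hne x hx _ s1) (hne x hx _ t1)]
  have hself : ∀ a b : Fin n, ∀ w : V,
      ρ (Equiv.swap a b) (w - ρ (Equiv.swap a b) w) = -(w - ρ (Equiv.swap a b) w) :=
    fun a b w ↦ by rw [map_sub, swap_apply_swap_apply, neg_sub]
  have hneg : ∀ a b : Fin n, ∀ w : V,
      -w - ρ (Equiv.swap a b) (-w) = -(w - ρ (Equiv.swap a b) w) :=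
    fun a b w ↦ by rw [map_neg]; abel
  have n12 := hne a₁ ha₁ b₂ hb₂
  have n13 := hne a₁ ha₁ b₃ hb₃
  have n21 := hne a₂ ha₂ b₁ hb₁
  have n23 := hne a₂ ha₂ b₃ hb₃
  have n31 := hne a₃ ha₃ b₁ hb₁
  have n32 := hne a₃ ha₃ b₂ hb₂
  have w1 := w0.adjoin_minus (hne a₁ ha₁ b₁ hb₁) (fun x ↦ hRa _ _ ha₁)
    (fun x ↦ (hRmem _).2.1) (by rw [hzdef, hself])
  have w2 := w1.adjoin_minus (hne a₂ ha₂ b₂ hb₂) (by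
      rintro ⟨_ | i, _ | _⟩
      exacts [h12, n21.symm, hRa _ _ ha₂, hRa _ _ ha₂]) (by
      rintro ⟨_ | i, _ | _⟩
      exacts [n12, k12, (hRmem _).2.2.1, (hRmem _).2.2.1])
    (by rw [hzdef, hcomm _ _ _ _ h12 n12 n21.symm k12, hself, hneg])
  have w3 := w2.adjoin_minus (hne a₃ ha₃ b₃ hb₃) (by
      rintro ⟨_ | _ | i, _ | _⟩
      exacts [h23, n32.symm, h13, n31.symm, hRa _ _ ha₃, hRa _ _ ha₃]) (by
      rintro ⟨_ | _ | i, _ | _⟩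
      exacts [n23, k23, n13, k13, (hRmem _).2.2.2, (hRmem _).2.2.2])
    (by rw [hzdef, hcomm _ _ _ _ h13 n13 n31.symm k13, hcomm _ _ _ _ h23 n23 n32.symm k23,
      hself, hneg, hneg])
  refine HasWeight.of_le w3 (by simp) ?_
  simp

/-- If the weight `(3, q)` does not occur then a vector which is fixed off `k ≥ 3` points can
be replaced by one which is fixed off `k - 1` points. -/
theorem FixedOff.exists_erase {S : Finset (Fin n)} {v : V} (h : FixedOff ρ S v) (hv : v ≠ 0)
    (hS : 3 ≤ S.card) {q : ℕ} (hq : 2 * q + S.card + 3 ≤ n) (hn : S.card + 10 ≤ n)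
    (hno : ¬ HasWeight ρ 3 q) : ∃ a ∈ S, ∃ w ≠ 0, FixedOff ρ (S.erase a) w := by
  classical
  by_contra! hcon
  obtain ⟨a₁, ha₁, a₂, ha₂, a₃, ha₃, h12, h13, h23⟩ := Finset.two_lt_card.mp hS
  obtain ⟨p, hp, hpv⟩ := exists_invariant_seminorm ρ hv
  have hsum : ∀ a ∈ S, ∑ b ∈ Sᶜ, ρ (Equiv.swap a b) v = -v := by
    intro a ha
    by_contra hne
    exact hcon a ha _ (fun h0 ↦ hne (eq_neg_of_add_eq_zero_right h0)) (h.sum_swap ha)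
  have hT : ∀ g x, p ((1 - ρ g) x) ≤ 2 * p x := by
    intro g x
    rw [LinearMap.sub_apply, Module.End.one_apply]
    refine (map_sub_le_add p _ _).trans (le_of_eq ?_)
    rw [hp]; ring
  have hN : 10 ≤ Sᶜ.card := by rw [Finset.card_compl, Fintype.card_fin]; omega
  have hN' : (10 : ℝ) ≤ Sᶜ.card := by exact_mod_cast hN
  set N : ℝ := (Sᶜ.card : ℝ)
  have e2 : ∀ b₁ ∈ Sᶜ, ∀ b₂ ∈ Sᶜ, b₁ ≠ b₂ → (N - 1) *
      p ((1 - ρ (Equiv.swap a₁ b₁)) ((1 - ρ (Equiv.swap a₂ b₂)) v)) ≤ 8 * p v := by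
    intro b₁ hb₁ b₂ hb₂ hne
    have hsub : ({b₁, b₂} : Finset (Fin n)) ⊆ Sᶜ := by
      simp [Finset.insert_subset_iff] at *
      exact ⟨hb₁, hb₂⟩
    have h1 := p.card_add_one_mul_le
      ((1 - ρ (Equiv.swap a₁ b₁)) ∘ₗ (1 - ρ (Equiv.swap a₂ b₂))) (v := v)
      (s := fun b ↦ ρ (Equiv.swap a₃ b) v) (R := Sᶜ) (B := Sᶜ \ {b₁, b₂})
      Finset.sdiff_subset (hsum a₃ ha₃) (c := 0) (C := 4 * p v) (fun b hb ↦ ?_) fun b _ ↦ ?_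
    · have h2 : Sᶜ \ (Sᶜ \ {b₁, b₂}) = {b₁, b₂} := by
        rw [Finset.sdiff_sdiff_eq_self hsub]
      rw [h2, Finset.card_sdiff_of_subset hsub, Finset.card_pair hne,
        Nat.cast_sub (by omega)] at h1
      simp only [LinearMap.comp_apply] at h1
      push_cast at h1
      convert h1 using 1
      · ring
      · ring
    · simp only [Finset.mem_sdiff, Finset.mem_insert, Finset.mem_singleton, not_or,
        Finset.mem_compl] at hb hb₁ hb₂
      apply le_of_eq
      rw [LinearMap.comp_apply]
      by_contra hz
      refine hno (h.hasWeight ha₁ ha₂ ha₃ h12 h13 h23 hb₁ hb₂ hb.1 hne (Ne.symm hb.2.1)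
        (Ne.symm hb.2.2) (fun h0 ↦ hz ?_) hq)
      rw [h0, map_zero]
    · rw [LinearMap.comp_apply]
      have := hT (Equiv.swap a₁ b₁) ((1 - ρ (Equiv.swap a₂ b₂)) (ρ (Equiv.swap a₃ b) v))
      have h3 := hT (Equiv.swap a₂ b₂) (ρ (Equiv.swap a₃ b) v)
      rw [hp] at h3
      linarith
  have e1 : ∀ b₁ ∈ Sᶜ, N * p ((1 - ρ (Equiv.swap a₁ b₁)) v) ≤ 10 * p v := by
    intro b₁ hb₁
    have hsub : ({b₁} : Finset (Fin n)) ⊆ Sᶜ := by simpa using hb₁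
    have h1 := p.card_add_one_mul_le (1 - ρ (Equiv.swap a₁ b₁)) (v := v)
      (s := fun b ↦ ρ (Equiv.swap a₂ b) v) (R := Sᶜ) (B := Sᶜ \ {b₁})
      Finset.sdiff_subset (hsum a₂ ha₂) (c := 8 * p v / (N - 1)) (C := 2 * p v)
      (fun b hb ↦ ?_) fun b _ ↦ ?_
    · have h2 : Sᶜ \ (Sᶜ \ {b₁}) = {b₁} := by
        rw [Finset.sdiff_sdiff_eq_self hsub]
      rw [h2, Finset.card_sdiff_of_subset hsub, Finset.card_singleton,
        Nat.cast_sub (by omega)] at h1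
      push_cast at h1
      change (N - 1 + 1) * _ ≤ (N - 1) * _ + _ at h1
      rw [mul_div_cancel₀ _ (by linarith)] at h1
      linarith
    · rw [Finset.mem_sdiff, Finset.mem_singleton] at hb
      rw [le_div_iff₀ (by linarith), mul_comm]
      exact e2 b₁ hb₁ b hb.1 (Ne.symm hb.2)
    · have := hT (Equiv.swap a₁ b₁) (ρ (Equiv.swap a₂ b) v)
      rwa [hp] at this
  have h1 := p.card_add_one_mul_le LinearMap.id (v := v)
      (s := fun b ↦ ρ (Equiv.swap a₁ b) v) (R := Sᶜ) (B := Sᶜ)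
      le_rfl (hsum a₁ ha₁) (c := 10 * p v / N) (C := 0)
      (fun b hb ↦ ?_) fun b hb ↦ by simp at hb
  · rw [Finset.sdiff_self, LinearMap.id_apply] at h1
    change (N + 1) * _ ≤ N * _ + _ at h1
    rw [mul_div_cancel₀ _ (by linarith)] at h1
    simp only [Finset.card_empty, Nat.cast_zero, zero_mul, add_zero] at h1
    have := le_of_mul_le_mul_right h1 hpv
    linarith
  · rw [LinearMap.id_apply, le_div_iff₀ (by linarith), mul_comm]
    exact e1 b hb

end

section
variable {n : ℕ} {V : Type} [AddCommGroup V] [Module ℂ V]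
  {ρ : Representation ℂ (Equiv.Perm (Fin n)) V}

/-- If the weight `(3, q)` does not occur and some nonzero vector is fixed off at most four
points, then a nonzero vector is fixed off at most two points. -/
theorem FixedOff.exists_card_le_two {S : Finset (Fin n)} {v : V} (h : FixedOff ρ S v)
    (hv : v ≠ 0) (hS : S.card ≤ 4) {q : ℕ} (hq : 2 * q + 7 ≤ n) (hn : 14 ≤ n)
    (hno : ¬ HasWeight ρ 3 q) : ∃ S : Finset (Fin n), S.card ≤ 2 ∧
      (∃ v ≠ 0, FixedOff ρ S v) ∧
      ∀ S' : Finset (Fin n), S'.card < S.card → ∀ w, FixedOff ρ S' w → w = 0 := by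
  classical
  let P : ℕ → Prop := fun k ↦ ∃ S : Finset (Fin n), S.card = k ∧ ∃ v ≠ 0, FixedOff ρ S v
  have hP : ∃ k, P k := ⟨_, S, rfl, v, hv, h⟩
  obtain ⟨S₁, hS₁, w, hw, hfix⟩ := Nat.find_spec hP
  have hle : Nat.find hP ≤ 4 := (Nat.find_min' hP ⟨S, rfl, v, hv, h⟩).trans hS
  have hmin : ∀ S' : Finset (Fin n), S'.card < S₁.card → ∀ w, FixedOff ρ S' w → w = 0 := by
    intro S' hS' x hx
    by_contra hne
    exact Nat.find_min hP (hS₁ ▸ hS') ⟨S', rfl, x, hne, hx⟩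
  refine ⟨S₁, ?_, ⟨w, hw, hfix⟩, hmin⟩
  by_contra! hcard
  obtain ⟨a, ha, x, hx, hfx⟩ := hfix.exists_erase hw hcard (q := q) (by omega) (by omega) hno
  exact hx (hmin _ (Finset.card_erase_lt_of_mem ha) x hfx)

theorem FixedOff.apply_eq {v : V} (h : FixedOff ρ ∅ v) (g : Equiv.Perm (Fin n)) : ρ g v = v :=
  h g (by simp)

end

section
variable {G V : Type} [Group G] [Fintype G] [AddCommGroup V] [Module ℂ V]
  {ρ : Representation ℂ G V} {lam : G → ℂ}

theorem IsScalarIrr.exists_eq_smul_of_fixed (h : IsScalarIrr ρ lam) {v : V} (hv : v ≠ 0)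
    (hfix : ∀ g, ρ g v = v) (x : V) : ∃ c : ℂ, c • v = x := by
  rcases h.irr (ℂ ∙ v) (fun g w hw ↦ by
    obtain ⟨c, rfl⟩ := Submodule.mem_span_singleton.mp hw
    rw [map_smul, hfix]
    exact hw) with h1 | h1
  · exact absurd (Submodule.span_singleton_eq_bot.mp h1) hv
  · exact Submodule.mem_span_singleton.mp (h1 ▸ Submodule.mem_top (x := x))

/-- An invariant positive form, used to evaluate the scalar by which a class sum acts. -/
theorem IsScalarIrr.exists_form (h : IsScalarIrr ρ lam) {X : Type} [Fintype X] [MulAction G X]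
    (u : X → V) (hu : ∀ (g : G) x, ρ g (u x) = u (g • x)) {x₀ : X} (hx₀ : u x₀ ≠ 0) (σ : G) :
    ∃ B : V → V →ₗ[ℂ] ℂ, (∀ g y x, B (ρ g y) (ρ g x) = B y x) ∧ B (u x₀) (u x₀) ≠ 0 ∧
      ∑ x, B (u x) (u (σ • x)) = lam σ * ∑ x, B (u x) (u x) := by
  obtain ⟨l, hl⟩ : ∃ l : Module.Dual ℂ V, l (u x₀) ≠ 0 := by
    by_contra! hcon
    exact hx₀ ((Module.forall_dual_apply_eq_zero_iff ℂ _).mp hcon)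
  let B : V → V →ₗ[ℂ] ℂ := fun y ↦ ∑ g, (starRingEnd ℂ (l (ρ g y))) • (l ∘ₗ ρ g)
  have hB : ∀ y x, B y x = ∑ g, (starRingEnd ℂ (l (ρ g y))) * l (ρ g x) := by
    intro y x
    simp [B]
  have hinv : ∀ g y x, B (ρ g y) (ρ g x) = B y x := by
    intro g y x
    rw [hB, hB]
    refine Fintype.sum_equiv (Equiv.mulRight g) _ _ fun k ↦ ?_
    rw [Equiv.coe_mulRight, map_mul, Module.End.mul_apply, Module.End.mul_apply]
  refine ⟨B, hinv, ?_, ?_⟩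
  · have h1 : B (u x₀) (u x₀) = ((∑ g, ‖l (ρ g (u x₀))‖ ^ 2 : ℝ) : ℂ) := by
      rw [hB]
      push_cast
      exact Finset.sum_congr rfl fun g _ ↦ Complex.conj_mul' _
    rw [h1, Complex.ofReal_ne_zero]
    apply ne_of_gt
    refine lt_of_lt_of_le ?_ (Finset.single_le_sum (f := fun g ↦ ‖l (ρ g (u x₀))‖ ^ 2)
      (fun _ _ ↦ by positivity) (Finset.mem_univ 1))
    simpa using pow_pos (norm_pos_iff.mpr hl) 2
  · have hG : (Fintype.card G : ℂ) ≠ 0 := by exact_mod_cast Fintype.card_ne_zero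
    apply mul_left_cancel₀ hG
    have h1 : ∀ x, (Fintype.card G : ℂ) * (lam σ * B (u x) (u x)) =
        ∑ g : G, B (u (g⁻¹ • x)) (u (σ • g⁻¹ • x)) := by
      intro x
      rw [← mul_assoc, ← smul_eq_mul, ← map_smul, ← h.avg, map_sum]
      refine Finset.sum_congr rfl fun g _ ↦ ?_
      rw [← hinv g⁻¹, hu, hu, hu]
      simp [mul_smul]
    rw [Finset.mul_sum (Finset.univ : Finset X) _ (lam σ),
      Finset.mul_sum Finset.univ (fun x ↦ lam σ * B (u x) (u x)),
      Finset.sum_congr rfl fun x _ ↦ h1 x, Finset.sum_comm,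
      Finset.sum_congr rfl (g := fun g : G ↦ ∑ x, B (u x) (u (σ • x)))]
    · simp
    · intro g _
      exact Fintype.sum_equiv (MulAction.toPerm g⁻¹) _ _ fun x ↦ rfl

end

theorem mul_eq_neg_sum_of_sum_eq_zero {n : ℕ} {f : Fin n → ℂ} (hf : ∑ a, f a = 0)
    {S : Finset (Fin n)} (hc : ∀ a ∉ S, ∀ b ∉ S, f a = f b) {a : Fin n} (ha : a ∉ S) :
    ((n : ℂ) - S.card) * f a = -∑ b ∈ S, f b := by
  classical
  have h1 : ∑ b ∈ Sᶜ, f b = ((n : ℂ) - S.card) * f a := by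
    rw [Finset.sum_congr rfl fun b hb ↦ hc b (by simpa using hb) a ha, Finset.sum_const,
      Finset.card_compl, nsmul_eq_mul, Fintype.card_fin,
      Nat.cast_sub (by simpa using Finset.card_le_univ S)]
  rw [← h1, ← sub_eq_zero, sub_neg_eq_add, ← hf, Finset.sum_compl_add_sum]

section
variable {n : ℕ} {V : Type} [AddCommGroup V] [Module ℂ V]
  {ρ : Representation ℂ (Equiv.Perm (Fin n)) V} {lam : Equiv.Perm (Fin n) → ℂ}

/-- The scalar of the standard representation. -/
theorem IsScalarIrr.lam_eq_of_fixedOff_one (h : IsScalarIrr ρ lam) (hn : 2 ≤ n)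
    {σ : Equiv.Perm (Fin n)} (hσ : fixCount σ = 2) {S : Finset (Fin n)} (hS : S.card = 1)
    {v : V} (hv : v ≠ 0) (hfix : FixedOff ρ S v)
    (hmin : ∀ S' : Finset (Fin n), S'.card < S.card → ∀ w, FixedOff ρ S' w → w = 0) :
    lam σ = 1 / ((n : ℂ) - 1) := by
  classical
  obtain ⟨p, rfl⟩ := Finset.card_eq_one.mp hS
  obtain ⟨u, hu, h₀, -⟩ := Representation.exists_equivariant ρ p (v := v)
    fun g hg ↦ hfix g (by simpa using hg)
  obtain ⟨B, hB, hBp, hsum⟩ := h.exists_form u hu (x₀ := p) (h₀ ▸ hv) σ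
  have hu0 : ∑ x, u x = 0 := by
    refine hmin ∅ (by simp) _ fun g _ ↦ ?_
    rw [map_sum]
    exact Fintype.sum_equiv g _ _ fun x ↦ hu g x
  set κ := B (u p) (u p)
  have hdiag : ∀ x, B (u x) (u x) = κ := by
    intro x
    have := hB (Equiv.swap p x) (u p) (u p)
    simpa [hu, Equiv.Perm.smul_def] using this
  have hn1 : (n : ℂ) - 1 ≠ 0 := by
    rw [sub_ne_zero]
    exact_mod_cast (by omega : n ≠ 1)
  have hoff : ∀ x y, y ≠ x → B (u x) (u y) = -κ / ((n : ℂ) - 1) := by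
    intro x y hxy
    have h1 := mul_eq_neg_sum_of_sum_eq_zero (f := fun y ↦ B (u x) (u y)) (S := {x})
      (by rw [← map_sum, hu0, map_zero]) (fun a ha b hb ↦ by
        have := hB (Equiv.swap a b) (u x) (u a)
        rw [hu, hu, Equiv.Perm.smul_def, Equiv.Perm.smul_def, Equiv.swap_apply_left,
          Equiv.swap_apply_of_ne_of_ne] at this
        · exact this.symm
        · rintro rfl; simp at ha
        · rintro rfl; simp at hb) (a := y) (by simpa using hxy)
    rw [Finset.sum_singleton, hdiag, Finset.card_singleton, Nat.cast_one] at h1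
    rw [eq_div_iff hn1, mul_comm, h1]
  have h2 : ∀ x, B (u x) (u (σ • x)) =
      -κ / ((n : ℂ) - 1) + if σ x = x then κ - -κ / ((n : ℂ) - 1) else 0 := by
    intro x
    rw [Equiv.Perm.smul_def]
    split_ifs with hx
    · rw [hx, hdiag]; ring
    · rw [hoff _ _ hx, add_zero]
  have hn0 : (n : ℂ) ≠ 0 := by exact_mod_cast (by omega : n ≠ 0)
  rw [Finset.sum_congr rfl fun x _ ↦ h2 x, Finset.sum_congr rfl fun x _ ↦ hdiag x,
    Finset.sum_add_distrib, ← Finset.sum_filter, Finset.sum_const, Finset.sum_const,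
    Finset.sum_const] at hsum
  have h3 : (Finset.univ.filter fun x ↦ σ x = x).card = 2 := hσ
  rw [h3] at hsum
  simp only [Finset.card_univ, Fintype.card_fin, nsmul_eq_mul] at hsum
  rw [← mul_assoc, mul_comm (lam σ)] at hsum
  field_simp at hsum ⊢
  apply mul_left_cancel₀ hn0
  push_cast at hsum
  linear_combination -hsum

theorem exists_perm_apply_eq_apply_eq {p q a b : Fin n} (hpq : p ≠ q) (hab : a ≠ b) :
    ∃ g : Equiv.Perm (Fin n), g p = a ∧ g q = b := by
  refine ⟨Equiv.swap (Equiv.swap p a q) b * Equiv.swap p a, ?_, ?_⟩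
  · rw [Equiv.Perm.mul_apply, Equiv.swap_apply_left, Equiv.swap_apply_of_ne_of_ne _ hab]
    intro h
    apply hpq
    apply (Equiv.swap p a).injective
    rw [← h, Equiv.swap_apply_left]
  · simp

theorem FixedOff.exists_swap_eq {p q : Fin n} {v : V} (h : FixedOff ρ {p, q} v) (hv : v ≠ 0) :
    ∃ (w : V) (ε : ℝ), w ≠ 0 ∧ FixedOff ρ {p, q} w ∧ (ε = 1 ∨ ε = -1) ∧
      ρ (Equiv.swap p q) w = (ε : ℂ) • w := by
  by_cases h0 : v + ρ (Equiv.swap p q) v = 0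
  · exact ⟨v, -1, hv, h, Or.inr rfl, by simpa using eq_neg_of_add_eq_zero_right h0⟩
  · refine ⟨_, 1, h0, fun g hg ↦ ?_, Or.inl rfl, ?_⟩
    · have h1 : g * Equiv.swap p q = Equiv.swap p q * g := by
        have := Equiv.swap_apply_apply g p q
        rw [hg p (by simp), hg q (by simp)] at this
        nth_rewrite 2 [this]
        group
      rw [map_add, h g hg, ← Module.End.mul_apply, ← map_mul, h1, map_mul, Module.End.mul_apply,
        h g hg]
    · rw [map_add, swap_apply_swap_apply, Complex.ofReal_one, one_smul, add_comm]

end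

section
variable {n : ℕ} {V : Type} [AddCommGroup V] [Module ℂ V]
  {ρ : Representation ℂ (Equiv.Perm (Fin n)) V} {lam : Equiv.Perm (Fin n) → ℂ}

/-- The values of an invariant form on the vectors `u (a, b)` spanning a representation with
a vector fixed off two points but none fixed off one point, in terms of the coefficients
`β = 1 / (n - 2)`, `γ = (1 + ε) / ((n - 2) (n - 3))`. -/
def pairKernel (ε β γ : ℝ) (x y a b : Fin n) : ℝ :=
  γ - (β + γ) * ((if a = x then 1 else 0) + if b = y then 1 else 0)
    - (ε * β + γ) * ((if a = y then 1 else 0) + if b = x then 1 else 0)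
    + (1 + 2 * β + γ) * ((if a = x then 1 else 0) * if b = y then 1 else 0)
    + (ε + 2 * ε * β + γ) * ((if a = y then 1 else 0) * if b = x then 1 else 0)

theorem form_eq_pairKernel {ε : ℝ} (hε : ε = 1 ∨ ε = -1) (hn : 4 ≤ n)
    {u : Fin n × Fin n → V} (hu : ∀ (g : Equiv.Perm (Fin n)) x, ρ g (u x) = u (g • x))
    (hdiag : ∀ a, u (a, a) = 0) (hswap : ∀ a b, u (b, a) = (ε : ℂ) • u (a, b))
    (hsum : ∀ b, ∑ a, u (a, b) = 0) {B : V → V →ₗ[ℂ] ℂ}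
    (hB : ∀ g y x, B (ρ g y) (ρ g x) = B y x) {κ : ℂ}
    {x y : Fin n} (hxy : x ≠ y) (hκ : B (u (x, y)) (u (x, y)) = κ) {a b : Fin n} (hab : a ≠ b) :
    B (u (x, y)) (u (a, b)) =
      (pairKernel ε (1 / ((n : ℝ) - 2)) ((1 + ε) / (((n : ℝ) - 2) * ((n : ℝ) - 3))) x y a b : ℝ)
        * κ := by
  classical
  have hεε : (ε : ℂ) * ε = 1 := by rcases hε with rfl | rfl <;> simp
  have hn2 : (n : ℂ) - 2 ≠ 0 := by
    rw [sub_ne_zero]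
    exact_mod_cast (by omega : n ≠ 2)
  have hn3 : (n : ℂ) - 3 ≠ 0 := by
    rw [sub_ne_zero]
    exact_mod_cast (by omega : n ≠ 3)
  have hinv : ∀ c d, c ≠ x → c ≠ y → d ≠ x → d ≠ y → ∀ b, c ≠ b → d ≠ b →
      B (u (x, y)) (u (c, b)) = B (u (x, y)) (u (d, b)) := by
    intro c d h1 h2 h3 h4 b h5 h6
    have := hB (Equiv.swap c d) (u (x, y)) (u (c, b))
    rw [hu, hu, Prod.smul_mk, Prod.smul_mk] at this
    simp only [Equiv.Perm.smul_def, Equiv.swap_apply_left] at this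
    rw [Equiv.swap_apply_of_ne_of_ne h1.symm h3.symm,
      Equiv.swap_apply_of_ne_of_ne h2.symm h4.symm,
      Equiv.swap_apply_of_ne_of_ne h5.symm h6.symm] at this
    exact this.symm
  have hsB : ∀ b, ∑ a, B (u (x, y)) (u (a, b)) = 0 := fun b ↦ by
    rw [← map_sum, hsum, map_zero]
  have hsw : ∀ a b, B (u (x, y)) (u (b, a)) = ε * B (u (x, y)) (u (a, b)) := fun a b ↦ by
    rw [hswap a b, map_smul, smul_eq_mul]
  have hd : ∀ a, B (u (x, y)) (u (a, a)) = 0 := fun a ↦ by rw [hdiag, map_zero]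
  have hcard : (({x, y} : Finset (Fin n)).card : ℂ) = 2 := by
    rw [Finset.card_pair hxy]; rfl
  have hay : ∀ a, a ≠ x → a ≠ y → B (u (x, y)) (u (a, y)) = -κ / ((n : ℂ) - 2) := by
    intro a h1 h2
    have := mul_eq_neg_sum_of_sum_eq_zero (hsB y) (S := {x, y}) (fun c hc d hd ↦ by
      simp only [Finset.mem_insert, Finset.mem_singleton, not_or] at hc hd
      exact hinv c d hc.1 hc.2 hd.1 hd.2 y hc.2 hd.2) (a := a) (by simp [h1, h2])
    rw [Finset.sum_pair hxy, hd, add_zero, hκ, hcard] at this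
    rw [eq_div_iff hn2, mul_comm, this]
  have hax : ∀ a, a ≠ x → a ≠ y → B (u (x, y)) (u (a, x)) = -(ε * κ) / ((n : ℂ) - 2) := by
    intro a h1 h2
    have := mul_eq_neg_sum_of_sum_eq_zero (hsB x) (S := {x, y}) (fun c hc d hd ↦ by
      simp only [Finset.mem_insert, Finset.mem_singleton, not_or] at hc hd
      exact hinv c d hc.1 hc.2 hd.1 hd.2 x hc.1 hd.1) (a := a) (by simp [h1, h2])
    rw [Finset.sum_pair hxy, hd, zero_add, hsw x y, hκ, hcard] at this
    rw [eq_div_iff hn2, mul_comm, this]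
  have hgen : ∀ a b, a ≠ b → a ≠ x → a ≠ y → b ≠ x → b ≠ y →
      B (u (x, y)) (u (a, b)) = (1 + ε) * κ / (((n : ℂ) - 2) * ((n : ℂ) - 3)) := by
    intro a b h0 h1 h2 h3 h4
    have := mul_eq_neg_sum_of_sum_eq_zero (hsB b) (S := {b, x, y}) (fun c hc d hd ↦ by
      simp only [Finset.mem_insert, Finset.mem_singleton, not_or] at hc hd
      exact hinv c d hc.2.1 hc.2.2 hd.2.1 hd.2.2 b hc.1 hd.1) (a := a) (by simp [h0, h1, h2])
    rw [Finset.sum_insert (by simp [h3, h4]), Finset.sum_pair hxy, hd, zero_add, hsw b x,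
      hsw b y, hax b h3 h4, hay b h3 h4, Finset.card_insert_of_notMem (by simp [h3, h4]),
      Finset.card_pair hxy] at this
    rw [eq_div_iff (mul_ne_zero hn2 hn3)]
    push_cast at this
    have h5 : ((n : ℂ) - 3) * B (u (x, y)) (u (a, b)) * ((n : ℂ) - 2) = (1 + ε) * κ := by
      norm_num at this
      rw [this]
      field_simp
      linear_combination κ * hεε
    linear_combination h5
  by_cases h1 : a = x
  · subst h1
    by_cases h2 : b = y
    · subst h2
      rw [hκ]
      simp [pairKernel, hab, hab.symm]
      ring
    · rw [hsw b a, hax b hab.symm h2]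
      simp [pairKernel, hab.symm, h2, hxy]
      field_simp
      linear_combination -κ * hεε
  · by_cases h2 : b = y
    · subst h2
      rw [hay a h1 hab]
      simp [pairKernel, h1, hab, hxy.symm]
      field_simp
    · by_cases h3 : a = y
      · subst h3
        by_cases h4 : b = x
        · subst h4
          rw [hsw b a, hκ]
          simp [pairKernel, hxy, hxy.symm]
          left
          ring
        · rw [hsw b a, hay b h4 h2]
          simp [pairKernel, h1, h2, h4]
          field_simp
      · by_cases h4 : b = x
        · subst h4
          rw [hax a h1 h3]
          simp [pairKernel, h1, h2, h3]
          field_simp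
        · rw [hgen a b hab h1 h3 h4 h2]
          simp [pairKernel, h1, h2, h3, h4]
          field_simp

theorem sum_pairKernel (ε β γ : ℝ) (σ : Equiv.Perm (Fin n)) (hσ : fixCount σ = 2) :
    ∑ x, ∑ y, (if x = y then 0 else pairKernel ε β γ x y (σ x) (σ y)) =
      γ * (n * (n - 1)) - (β + γ) * (4 * n - 4) - (ε * β + γ) * (2 * n - 4)
        + 2 * (1 + 2 * β + γ) + (ε + 2 * ε * β + γ) *
          ((Finset.univ.filter fun x ↦ σ (σ x) = x).card - 2) := by
  have h1 : ∑ x, (if σ x = x then (1 : ℝ) else 0) = 2 := by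
    rw [← Finset.sum_filter, Finset.sum_const, nsmul_eq_mul, mul_one]
    exact_mod_cast hσ
  have h2 : ∑ x, (if σ (σ x) = x then (1 : ℝ) else 0) =
      (Finset.univ.filter fun x ↦ σ (σ x) = x).card := by
    rw [← Finset.sum_filter, Finset.sum_const, nsmul_eq_mul, mul_one]
  have h3 : ∀ x, ∑ y, (if σ x = y then (1 : ℝ) else 0) = 1 := fun x ↦ by simp
  have h4 : ∀ x, ∑ y, (if σ y = x then (1 : ℝ) else 0) = 1 := fun x ↦ by
    rw [Finset.sum_congr rfl (g := fun y ↦ if σ⁻¹ x = y then (1 : ℝ) else 0)]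
    · simp
    · intro y _
      congr 1
      rw [eq_iff_iff, Equiv.Perm.inv_eq_iff_eq, eq_comm]
  have h5 : ∀ x, ∑ y, (if σ x = y then (1 : ℝ) else 0) * (if σ y = x then 1 else 0) =
      if σ (σ x) = x then 1 else 0 := fun x ↦ by simp only [ite_mul, one_mul, zero_mul,
        Finset.sum_ite_eq, Finset.mem_univ, if_true]
  have h6 : ∀ x, ∑ y, (if x = y then 0 else pairKernel ε β γ x y (σ x) (σ y)) =
      ∑ y, pairKernel ε β γ x y (σ x) (σ y) - pairKernel ε β γ x x (σ x) (σ x) := by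
    intro x
    rw [eq_sub_iff_add_eq, ← Finset.sum_erase_add _ _ (Finset.mem_univ x),
      ← Finset.sum_erase_add _ _ (Finset.mem_univ x), if_pos rfl, add_zero]
    congr 1
    refine Finset.sum_congr rfl fun y hy ↦ if_neg (Finset.ne_of_mem_erase hy).symm
  have h7 : ∀ x, pairKernel ε β γ x x (σ x) (σ x) =
      γ + (1 + ε + 2 * ε * β - 2 * γ - 2 * ε * β) * (if σ x = x then 1 else 0) := by
    intro x
    unfold pairKernel
    split_ifs <;> ring
  rw [Finset.sum_congr rfl fun x _ ↦ h6 x, Finset.sum_sub_distrib,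
    Finset.sum_congr rfl fun x _ ↦ h7 x]
  simp only [pairKernel, Finset.sum_add_distrib, Finset.sum_sub_distrib, ← Finset.mul_sum,
    ← Finset.sum_mul, h1, h2, h3, h4, h5, Finset.sum_const, Finset.card_univ,
    Fintype.card_fin, nsmul_eq_mul]
  ring

end

theorem abs_pair_sum_le {n N : ℝ} (hn : 5 ≤ n) (hN : 2 ≤ N) (hNn : N ≤ n) {ε : ℝ}
    (hε : ε = 1 ∨ ε = -1) {β γ : ℝ} (hβ : β = 1 / (n - 2))
    (hγ : γ = (1 + ε) / ((n - 2) * (n - 3))) :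
    |γ * (n * (n - 1)) - (β + γ) * (4 * n - 4) - (ε * β + γ) * (2 * n - 4)
        + 2 * (1 + 2 * β + γ) + (ε + 2 * ε * β + γ) * (N - 2)| ≤ n := by
  have h2 : 0 < n - 2 := by linarith
  have h3 : 0 < n - 3 := by linarith
  rcases hε with rfl | rfl
  · have h : γ * (n * (n - 1)) - (β + γ) * (4 * n - 4) - (1 * β + γ) * (2 * n - 4)
        + 2 * (1 + 2 * β + γ) + (1 + 2 * 1 * β + γ) * (N - 2) =
        (2 * (n - 5) - 4 * (n - 3) + (n - 1) * (N - 2)) / (n - 3) := by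
      rw [hβ, hγ]
      field_simp
      ring
    rw [h, abs_le, le_div_iff₀ h3, div_le_iff₀ h3]
    constructor <;> nlinarith
  · have h : γ * (n * (n - 1)) - (β + γ) * (4 * n - 4) - (-1 * β + γ) * (2 * n - 4)
        + 2 * (1 + 2 * β + γ) + (-1 + 2 * (-1) * β + γ) * (N - 2) =
        -(n * (N - 2)) / (n - 2) := by
      rw [hβ, hγ]
      field_simp
      ring
    rw [h, abs_le, le_div_iff₀ h2, div_le_iff₀ h2]
    constructor <;> nlinarith

section
variable {n : ℕ} {V : Type} [AddCommGroup V] [Module ℂ V]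
  {ρ : Representation ℂ (Equiv.Perm (Fin n)) V} {lam : Equiv.Perm (Fin n) → ℂ}

theorem IsScalarIrr.norm_lam_le_of_fixedOff_two (h : IsScalarIrr ρ lam) (hn : 5 ≤ n)
    {σ : Equiv.Perm (Fin n)} (hσ : fixCount σ = 2) {S : Finset (Fin n)} (hS : S.card = 2)
    {v : V} (hv : v ≠ 0) (hfix : FixedOff ρ S v)
    (hmin : ∀ S' : Finset (Fin n), S'.card < S.card → ∀ w, FixedOff ρ S' w → w = 0) :
    ‖lam σ‖ ≤ 1 / ((n : ℝ) - 1) := by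
  classical
  rw [hS] at hmin
  obtain ⟨p, q, hpq, rfl⟩ := Finset.card_eq_two.mp hS
  obtain ⟨w, ε, hw, hfw, hε, hsw⟩ := hfix.exists_swap_eq hv
  obtain ⟨u, hu, h₀, hout⟩ := Representation.exists_equivariant ρ (p, q) (v := w)
    fun g hg ↦ hfw g (by simpa [Prod.ext_iff] using hg)
  obtain ⟨B, hB, hBp, hsum⟩ := h.exists_form u hu (x₀ := (p, q)) (h₀ ▸ hw) σ
  have hdiag : ∀ a, u (a, a) = 0 := by
    refine fun a ↦ hout _ fun g hg ↦ hpq (g.injective ?_)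
    have h1 := congrArg Prod.fst hg
    have h2 := congrArg Prod.snd hg
    exact h1.trans h2.symm
  have hpair : ∀ a b, a ≠ b → ∃ g : Equiv.Perm (Fin n), u (a, b) = ρ g (u (p, q)) ∧
      u (b, a) = ρ g (u (q, p)) := by
    intro a b hab
    obtain ⟨g, rfl, rfl⟩ := exists_perm_apply_eq_apply_eq hpq hab
    exact ⟨g, by rw [hu]; rfl, by rw [hu]; rfl⟩
  have hswap : ∀ a b, u (b, a) = (ε : ℂ) • u (a, b) := by
    intro a b
    by_cases hab : a = b
    · subst hab; rw [hdiag, smul_zero]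
    · obtain ⟨g, h1, h2⟩ := hpair a b hab
      have h3 : u (q, p) = (ε : ℂ) • u (p, q) := by
        rw [h₀, ← hsw, ← h₀, hu]
        simp
      rw [h1, h2, h3, map_smul]
  have hsum0 : ∀ b, ∑ a, u (a, b) = 0 := by
    refine fun b ↦ hmin {b} (by simp) _ fun g hg ↦ ?_
    rw [map_sum]
    refine Fintype.sum_equiv g _ _ fun a ↦ ?_
    have hgb : g b = b := hg b (by simp)
    rw [hu, Prod.smul_mk, Equiv.Perm.smul_def, Equiv.Perm.smul_def, hgb]
  set κ := B (u (p, q)) (u (p, q))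
  have hκ : ∀ x y, x ≠ y → B (u (x, y)) (u (x, y)) = κ := by
    intro x y hxy
    obtain ⟨g, h1, -⟩ := hpair x y hxy
    rw [h1, hB]
  set β : ℝ := 1 / ((n : ℝ) - 2) with hβ
  set γ : ℝ := (1 + ε) / (((n : ℝ) - 2) * ((n : ℝ) - 3)) with hγ
  have hL : ∑ x, B (u x) (u (σ • x)) =
      ((∑ x, ∑ y, (if x = y then 0 else pairKernel ε β γ x y (σ x) (σ y)) : ℝ) : ℂ) * κ := by
    rw [Fintype.sum_prod_type]
    push_cast
    rw [Finset.sum_mul]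
    refine Finset.sum_congr rfl fun x _ ↦ ?_
    rw [Finset.sum_mul]
    refine Finset.sum_congr rfl fun y _ ↦ ?_
    by_cases hxy : x = y
    · subst hxy
      rw [if_pos rfl, Complex.ofReal_zero, zero_mul]
      exact (congrArg _ (hdiag (σ x))).trans (map_zero _)
    · rw [if_neg hxy]
      exact form_eq_pairKernel hε (by omega) hu hdiag hswap hsum0 hB hxy (hκ x y hxy)
        fun h' ↦ hxy (σ.injective h')
  have hR : ∑ x, B (u x) (u x) = ((n : ℂ) * (n - 1)) * κ := by
    rw [Fintype.sum_prod_type]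
    have h1 : ∀ x, ∑ y, B (u (x, y)) (u (x, y)) = ((n : ℂ) - 1) * κ := by
      intro x
      rw [← Finset.sum_erase_add _ _ (Finset.mem_univ x), hdiag, map_zero, add_zero,
        Finset.sum_congr rfl fun y hy ↦ hκ x y (Finset.ne_of_mem_erase hy).symm,
        Finset.sum_const, Finset.card_erase_of_mem (Finset.mem_univ x), nsmul_eq_mul,
        Finset.card_univ, Fintype.card_fin, Nat.cast_sub (by omega), Nat.cast_one]
    rw [Finset.sum_congr rfl fun x _ ↦ h1 x, Finset.sum_const, nsmul_eq_mul, Finset.card_univ,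
      Fintype.card_fin, mul_assoc]
  rw [hL, hR, sum_pairKernel ε β γ σ hσ] at hsum
  have hN1 : 2 ≤ (Finset.univ.filter fun x ↦ σ (σ x) = x).card := by
    rw [← hσ]
    refine Finset.card_le_card fun x hx ↦ ?_
    simp only [Finset.mem_filter, Finset.mem_univ, true_and] at hx ⊢
    rw [hx, hx]
  have hN2 : (Finset.univ.filter fun x ↦ σ (σ x) = x).card ≤ n := by
    simpa using Finset.card_le_univ (Finset.univ.filter fun x ↦ σ (σ x) = x)
  have hn' : (5 : ℝ) ≤ n := by exact_mod_cast hn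
  have hb := abs_pair_sum_le (n := n) hn' (N := (Finset.univ.filter fun x ↦ σ (σ x) = x).card)
    (by exact_mod_cast hN1) (by exact_mod_cast hN2) hε hβ hγ
  have heq := congrArg norm (mul_right_cancel₀ hBp (hsum.trans (mul_assoc _ _ _).symm))
  rw [Complex.norm_real, Real.norm_eq_abs, norm_mul] at heq
  have hnorm : ‖(n : ℂ) * (n - 1)‖ = (n : ℝ) * (n - 1) := by
    have : (n : ℂ) * (n - 1) = (((n : ℝ) * (n - 1) : ℝ) : ℂ) := by push_cast; ring
    rw [this, Complex.norm_real, Real.norm_eq_abs, abs_of_nonneg (by nlinarith)]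
  rw [heq, hnorm] at hb
  rw [le_div_iff₀ (by linarith)]
  have hn0 : (0 : ℝ) < n := by linarith
  nlinarith

/-- A representation in which some nonzero vector is fixed off at most four points. -/
theorem IsScalarIrr.norm_lam_le_of_fixedOff (h : IsScalarIrr ρ lam) (hn : 14 ≤ n)
    {σ : Equiv.Perm (Fin n)} (hσ : fixCount σ = 2) {S : Finset (Fin n)} (hS : S.card ≤ 4)
    {v : V} (hv : v ≠ 0) (hfix : FixedOff ρ S v) {q : ℕ} (hq : 2 * q + 7 ≤ n)
    (hno : ¬ HasWeight ρ 3 q) :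
    ‖lam σ‖ ≤ 1 / ((n : ℝ) - 1) ∨ ∃ v ≠ 0, ∀ g, ρ g v = v := by
  obtain ⟨S, hS, ⟨v, hv, hfix⟩, hmin⟩ := hfix.exists_card_le_two hv hS hq hn hno
  have hcases : S.card = 0 ∨ S.card = 1 ∨ S.card = 2 := by omega
  rcases hcases with hS | hS | hS
  · rw [Finset.card_eq_zero] at hS
    subst hS
    exact Or.inr ⟨v, hv, hfix.apply_eq⟩
  · left
    rw [h.lam_eq_of_fixedOff_one (by omega) hσ hS hv hfix hmin]
    have h1 : (1 : ℂ) / ((n : ℂ) - 1) = ((1 / ((n : ℝ) - 1) : ℝ) : ℂ) := by push_cast; rfl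
    have hn' : (14 : ℝ) ≤ n := by exact_mod_cast hn
    rw [h1, Complex.norm_real, Real.norm_eq_abs, abs_of_nonneg]
    exact div_nonneg zero_le_one (by linarith)
  · exact Or.inl (h.norm_lam_le_of_fixedOff_two (by omega) hσ hS hv hfix hmin)

end

section
variable {n : ℕ} {V : Type} [AddCommGroup V] [Module ℂ V]
  {ρ : Representation ℂ (Equiv.Perm (Fin n)) V} {lam : Equiv.Perm (Fin n) → ℂ}

/-- The sign of a permutation as a complex number. -/
def complexSign (g : Equiv.Perm (Fin n)) : ℂ := ((Equiv.Perm.sign g : ℤ) : ℂ)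

theorem complexSign_mul (g k : Equiv.Perm (Fin n)) :
    complexSign (g * k) = complexSign g * complexSign k := by
  simp [complexSign]

theorem complexSign_eq_or (g : Equiv.Perm (Fin n)) : complexSign g = 1 ∨ complexSign g = -1 := by
  rcases Int.units_eq_one_or (Equiv.Perm.sign g) with h | h <;> simp [complexSign, h]

theorem complexSign_mul_self (g : Equiv.Perm (Fin n)) : complexSign g * complexSign g = 1 := by
  rcases complexSign_eq_or g with h | h <;> simp [h]

/-- The tensor product of a representation with the sign character. -/
def signTwist (ρ : Representation ℂ (Equiv.Perm (Fin n)) V) :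
    Representation ℂ (Equiv.Perm (Fin n)) V where
  toFun g := complexSign g • ρ g
  map_one' := by simp [complexSign]
  map_mul' g k := by
    rw [complexSign_mul, map_mul, smul_mul_smul_comm]

theorem signTwist_apply (g : Equiv.Perm (Fin n)) (v : V) :
    signTwist ρ g v = complexSign g • ρ g v := rfl

theorem IsScalarIrr.signTwist (h : IsScalarIrr ρ lam) :
    IsScalarIrr (signTwist ρ) fun σ ↦ complexSign σ * lam σ where
  nontrivial := h.nontrivial
  irr W hW := h.irr W fun g v hv ↦ by
    have := W.smul_mem (complexSign g) (hW g v hv)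
    rwa [signTwist_apply, smul_smul, complexSign_mul_self, one_smul] at this
  avg σ v := by
    have h1 : ∀ g : Equiv.Perm (Fin n), complexSign (g * σ * g⁻¹) = complexSign σ := fun g ↦ by
      simp only [complexSign, Equiv.Perm.sign_mul, Equiv.Perm.sign_inv]
      rw [mul_comm, ← mul_assoc, Int.units_mul_self, one_mul]
    simp only [signTwist_apply, h1]
    rw [← Finset.smul_sum, h.avg, smul_smul]
    congr 1
    ring

theorem HasWeight.signTwist {p q : ℕ} (h : HasWeight ρ p q) : HasWeight (signTwist ρ) q p := by
  classical
  obtain ⟨ι, _, e, A, u, hu, hA, hc⟩ := h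
  have hs : ∀ i, complexSign (Equiv.swap (e (i, false)) (e (i, true))) = -1 := by
    intro i
    have hne : e (i, false) ≠ e (i, true) := fun h' ↦ by simpa using hu.inj h'
    simp [complexSign, Equiv.Perm.sign_swap hne]
  refine ⟨ι, inferInstance, e, Aᶜ, u, ⟨hu.inj, hu.ne_zero, fun i hi ↦ ?_, fun i hi ↦ ?_⟩, ?_, ?_⟩
  · rw [signTwist_apply, hs, hu.plus i (by simpa using hi), neg_one_smul]
  · rw [signTwist_apply, hs, hu.minus i (by simpa using hi), neg_one_smul, neg_neg]
  · rw [Finset.card_compl]; omega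
  · omega

theorem HasWeight.exists_of_le [Nontrivial V] {m : ℕ} (hm : 2 * m ≤ n) :
    ∃ p ≤ m, HasWeight ρ p (m - p) := by
  induction m with
  | zero => exact ⟨0, le_rfl, HasWeight.zero⟩
  | succ m ih =>
    obtain ⟨p, hp, h⟩ := ih (by omega)
    rcases h.extend (by omega) with h | h
    · exact ⟨p + 1, by omega, by convert h using 1; omega⟩
    · exact ⟨p, by omega, by convert h using 1; omega⟩

theorem choose_le_choose_of_mem_Icc {m K p : ℕ} (hK : K ≤ p) (hp : p + K ≤ m) :
    m.choose K ≤ m.choose p := by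
  have key : ∀ p, K ≤ p → 2 * p ≤ m → m.choose K ≤ m.choose p := by
    intro p hp
    induction p, hp using Nat.le_induction with
    | base => exact fun _ ↦ le_rfl
    | succ p hp ih =>
      intro h
      exact (ih (by omega)).trans (Nat.choose_le_succ_of_lt_half_left (by omega))
  by_cases h : 2 * p ≤ m
  · exact key p hK h
  · rw [← Nat.choose_symm (by omega : p ≤ m)]
    exact key (m - p) (by omega) (by omega)

theorem HasWeight.lt_or_lt [FiniteDimensional ℂ V] {m K p : ℕ} (h : HasWeight ρ p (m - p))
    (hp : p ≤ m) (hd : Module.finrank ℂ V < m.choose K) : p < K ∨ m < p + K := by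
  by_contra! hcon
  have h1 := h.choose_le_finrank
  rw [Nat.add_sub_cancel' hp] at h1
  have := choose_le_choose_of_mem_Icc hcon.1 hcon.2
  omega

/-- The case of a representation of small dimension having a weight with few minus signs. -/
theorem IsScalarIrr.norm_lam_le_or_of_hasWeight [FiniteDimensional ℂ V] (h : IsScalarIrr ρ lam)
    {σ : Equiv.Perm (Fin n)} (hσ : fixCount σ = 2) {m K : ℕ} (hm : 2 * m ≤ n)
    (hm' : 14 ≤ n) (hK : 3 ≤ K) (hKm : 2 * K + 2 ≤ m) (hKn : 32 * K ^ 2 ≤ n)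
    (hd : Module.finrank ℂ V < m.choose K) (hex : ∃ p < K, HasWeight ρ p (m - p)) :
    ‖lam σ‖ ≤ 1 / ((n : ℝ) - 1) ∨ (∃ v ≠ 0, ∀ g, ρ g v = v) ∨
      ∃ w, 3 ≤ w ∧ w < K ∧ m.choose w ≤ Module.finrank ℂ V ∧
        (Module.finrank ℂ V : ℝ) * ‖lam σ‖ ^ 2 ≤ 3 * (16 * w : ℝ) ^ (2 * w) := by
  obtain ⟨w, hwK, hw, hmax, S, hS, v, hv, hfix⟩ := HasWeight.exists_maximal hm (by omega) hex
    fun p h1 h2 h3 ↦ by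
      rcases h3.lt_or_lt (by omega) hd with h4 | h4 <;> omega
  by_cases hw3 : 3 ≤ w
  · right; right
    refine ⟨w, hw3, hwK, ?_, ?_⟩
    · have := hw.choose_le_finrank
      rwa [Nat.add_sub_cancel' (by omega)] at this
    · have h1 := h.finrank_mul_sq_le_of_fix_tuple hσ.le (s := 2 * w) (by omega)
        (by nlinarith [Nat.pow_le_pow_left hwK.le 2]) (fun i ↦ (S.equivFinOfCardEq hS).symm i) hv
        fun g hg ↦ hfix g fun x hx ↦ by
          simpa using hg (S.equivFinOfCardEq hS ⟨x, hx⟩)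
      convert h1 using 3
      push_cast
      ring
  · have hno : ¬ HasWeight ρ 3 (m - 4) := by
      intro h3
      rcases h3.extend (by omega) with h4 | h4
      · exact hmax 4 (by omega) (by omega) h4
      · exact hmax 3 (by omega) (by omega) (by convert h4 using 1; omega)
    rcases h.norm_lam_le_of_fixedOff hm' hσ (by omega) hv hfix (q := m - 4) (by omega) hno
      with h1 | h1
    · exact Or.inl h1
    · exact Or.inr (Or.inl h1)

/-- The case of a representation of small dimension. -/
theorem IsScalarIrr.norm_lam_le_or [FiniteDimensional ℂ V] (h : IsScalarIrr ρ lam)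
    {σ : Equiv.Perm (Fin n)} (hσ : fixCount σ = 2) {m K : ℕ} (hm : 2 * m ≤ n)
    (hm' : 14 ≤ n) (hK : 3 ≤ K) (hKm : 2 * K + 2 ≤ m) (hKn : 32 * K ^ 2 ≤ n)
    (hd : Module.finrank ℂ V < m.choose K) :
    ‖lam σ‖ ≤ 1 / ((n : ℝ) - 1) ∨
      (∃ v ≠ 0, ∀ g, ρ g v = v) ∨ (∃ v ≠ 0, ∀ g, ρ g v = complexSign g • v) ∨
      ∃ w, 3 ≤ w ∧ w < K ∧ m.choose w ≤ Module.finrank ℂ V ∧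
        (Module.finrank ℂ V : ℝ) * ‖lam σ‖ ^ 2 ≤ 3 * (16 * w : ℝ) ^ (2 * w) := by
  have := h.nontrivial
  obtain ⟨p, hp, hwt⟩ := HasWeight.exists_of_le (ρ := ρ) hm
  rcases hwt.lt_or_lt hp hd with h1 | h1
  · rcases h.norm_lam_le_or_of_hasWeight hσ hm hm' hK hKm hKn hd ⟨p, h1, hwt⟩ with h2 | h2 | h2
    · exact Or.inl h2
    · exact Or.inr (Or.inl h2)
    · exact Or.inr (Or.inr (Or.inr h2))
  · have hnorm : ‖complexSign σ * lam σ‖ = ‖lam σ‖ := by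
      rcases complexSign_eq_or σ with h2 | h2 <;> simp [h2]
    have h2 := h.signTwist.norm_lam_le_or_of_hasWeight hσ hm hm' hK hKm hKn hd
      ⟨m - p, by omega, by convert hwt.signTwist using 1; omega⟩
    simp only [hnorm] at h2
    rcases h2 with h2 | ⟨v, hv, h2⟩ | h2
    · exact Or.inl h2
    · refine Or.inr (Or.inr (Or.inl ⟨v, hv, fun g ↦ ?_⟩))
      nth_rewrite 2 [← h2 g]
      rw [signTwist_apply, smul_smul, complexSign_mul_self, one_smul]
    · exact Or.inr (Or.inr (Or.inr h2))

theorem IsScalarIrr.exists_eq_smul_of_sign (h : IsScalarIrr ρ lam) {v : V} (hv : v ≠ 0)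
    (hfix : ∀ g, ρ g v = complexSign g • v) (x : V) : ∃ c : ℂ, c • v = x :=
  h.signTwist.exists_eq_smul_of_fixed hv (fun g ↦ by
    rw [signTwist_apply, hfix, smul_smul, complexSign_mul_self, one_smul]) x

end

theorem FDRep.character_eq_of_smul {G : Type} [Group G] (V : FDRep ℂ G) {v : V} (hv : v ≠ 0)
    (hspan : ∀ x : V, ∃ c : ℂ, c • v = x) {f : G → ℂ} (hf : ∀ g, V.ρ g v = f g • v) :
    V.character = f := by
  have h1 : Module.finrank ℂ V = 1 := (finrank_eq_one_iff_of_nonzero' v hv).mpr hspan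
  ext g
  have h2 : V.ρ g = f g • LinearMap.id := by
    ext x
    obtain ⟨c, rfl⟩ := hspan x
    rw [map_smul, hf, LinearMap.smul_apply, LinearMap.id_apply, smul_comm]
  change LinearMap.trace ℂ V (V.ρ g) = f g
  rw [h2, map_smul, LinearMap.trace_id, h1]
  simp

theorem pow_le_choose_mul {n m K w : ℕ} (hnm : n ≤ 2 * m + 1) (hK : 6 * K ≤ n) (hw : w ≤ K) :
    n ^ w ≤ m.choose w * (3 * w) ^ w := by
  have h1 : (m + 1 - w) ^ w ≤ w.factorial * m.choose w := by
    have h := Nat.pow_le_choose (α := ℚ) w m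
    rw [div_le_iff₀' (by exact_mod_cast w.factorial_pos)] at h
    exact_mod_cast h
  have h2 : n ^ w ≤ (3 * (m + 1 - w)) ^ w := Nat.pow_le_pow_left (by omega) w
  calc n ^ w ≤ 3 ^ w * (m + 1 - w) ^ w := by rwa [← mul_pow]
    _ ≤ 3 ^ w * (w.factorial * m.choose w) := Nat.mul_le_mul_left _ h1
    _ ≤ 3 ^ w * (w ^ w * m.choose w) :=
      Nat.mul_le_mul_left _ (Nat.mul_le_mul_right _ (Nat.factorial_le_pow w))
    _ = m.choose w * (3 * w) ^ w := by rw [mul_pow]; ring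

theorem eventually_mul_log_pow_le (C k : ℕ) :
    ∀ᶠ n : ℕ in Filter.atTop, C * (Nat.log 2 n + 1) ^ k ≤ n := by
  have h1 : Filter.Tendsto (fun l : ℕ ↦ (l : ℝ) ^ k / (2 : ℝ) ^ l) Filter.atTop (nhds 0) :=
    tendsto_pow_const_div_const_pow_of_one_lt k one_lt_two
  have h2 : ∀ᶠ l : ℕ in Filter.atTop, (l : ℝ) ^ k / (2 : ℝ) ^ l < 1 / (2 * (C + 1)) :=
    h1.eventually (gt_mem_nhds (by positivity))
  have hlog : Filter.Tendsto (fun n : ℕ ↦ Nat.log 2 n + 1) Filter.atTop Filter.atTop := by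
    refine Filter.tendsto_atTop.mpr fun b ↦ ?_
    filter_upwards [Filter.eventually_ge_atTop (2 ^ b)] with n hn
    exact (Nat.le_log_of_pow_le one_lt_two hn).trans (Nat.le_succ _)
  filter_upwards [hlog.eventually h2, Filter.eventually_ge_atTop 1] with n hn hn1
  rw [div_lt_div_iff₀ (by positivity) (by positivity), one_mul] at hn
  have h3 : (2 : ℝ) ^ (Nat.log 2 n + 1) ≤ 2 * n := by
    rw [pow_succ, mul_comm]
    have := Nat.pow_log_le_self 2 (by omega : n ≠ 0)
    have : (2 : ℝ) ^ Nat.log 2 n ≤ n := by exact_mod_cast this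
    linarith
  have h4 : (C : ℝ) * ((Nat.log 2 n + 1 : ℕ) : ℝ) ^ k ≤ n := by
    have : (0 : ℝ) ≤ ((Nat.log 2 n + 1 : ℕ) : ℝ) ^ k := by positivity
    nlinarith
  exact_mod_cast h4

theorem le_one_div_sub_one_of_sq_le {n : ℕ} (hn : 2 ≤ n) {x : ℝ} (h : (n : ℝ) ^ 2 * x ^ 2 ≤ 1) :
    x ≤ 1 / ((n : ℝ) - 1) := by
  have hn' : (2 : ℝ) ≤ n := by exact_mod_cast hn
  rw [← mul_pow] at h
  have h1 := (abs_le_one_iff_mul_self_le_one.mpr (by rwa [← sq]) : |(n : ℝ) * x| ≤ 1)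
  have h2 := (abs_le.mp h1).2
  have h3 : x ≤ 1 / n := by rw [le_div_iff₀ (by linarith)]; linarith
  exact h3.trans (one_div_le_one_div_of_le (by linarith) (by linarith))

/-- The bound on a scalar in a representation of large dimension. -/
theorem sq_mul_le_one_of_large {n T : ℕ} {d x : ℝ} (hn : 200000 ≤ n) (hT : n ^ 11 ≤ 2 ^ T)
    (hd : (n : ℝ) ^ (T + 6) ≤ d)
    (h : x ≤ 324 * ((n : ℝ) + 1) ^ 8 / 2 ^ T + √((n : ℝ) ^ T / d)) :
    (n : ℝ) ^ 2 * x ≤ 1 := by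
  have hn' : (200000 : ℝ) ≤ n := by exact_mod_cast hn
  have hn0 : (0 : ℝ) < n := by linarith
  have hT' : (n : ℝ) ^ 11 ≤ 2 ^ T := by exact_mod_cast hT
  have h1 : 324 * ((n : ℝ) + 1) ^ 8 / 2 ^ T ≤ 324 * (2 * n) ^ 8 / n ^ 11 := by
    gcongr
    linarith
  have h2 : 324 * (2 * (n : ℝ)) ^ 8 / n ^ 11 = 82944 / n ^ 3 := by
    field_simp
    norm_num
  have h3 : √((n : ℝ) ^ T / d) ≤ 1 / n ^ 3 := by
    rw [Real.sqrt_le_left (by positivity)]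
    calc (n : ℝ) ^ T / d ≤ n ^ T / n ^ (T + 6) := by gcongr
      _ = (1 / n ^ 3) ^ 2 := by rw [pow_add]; field_simp
  have h4 : x ≤ 82945 / n ^ 3 := by
    have : (82945 : ℝ) / n ^ 3 = 82944 / n ^ 3 + 1 / n ^ 3 := by ring
    linarith
  calc (n : ℝ) ^ 2 * x ≤ (n : ℝ) ^ 2 * (82945 / (n : ℝ) ^ 3) := by gcongr
    _ = 82945 / (n : ℝ) := by field_simp
    _ ≤ 1 := by rw [div_le_one hn0]; linarith

/-- The bound on a scalar in a representation with few minus signs. -/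
theorem sq_mul_le_one_of_small {n m K w : ℕ} {d x : ℝ} (hx : 0 ≤ x) (hnm : n ≤ 2 * m + 1)
    (hK : 10 ^ 10 * K ^ 9 ≤ n) (hw3 : 3 ≤ w) (hw : w ≤ K) (hd : (m.choose w : ℝ) ≤ d)
    (h : d * x ≤ 3 * (16 * w : ℝ) ^ (2 * w)) : (n : ℝ) ^ 2 * x ≤ 1 := by
  have hK1 : 1 ≤ K := by omega
  have hKn : 768 * K ^ 3 ≤ n := by
    have : K ^ 3 ≤ K ^ 9 := Nat.pow_le_pow_right hK1 (by norm_num)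
    omega
  have h6K : 6 * K ≤ n := by
    have : K ≤ K ^ 9 := Nat.le_self_pow (by norm_num) K
    omega
  have h1 : (n : ℝ) ^ w ≤ m.choose w * (3 * w) ^ w := by
    exact_mod_cast pow_le_choose_mul hnm h6K hw
  have hn0 : (0 : ℝ) < n := by exact_mod_cast (by omega : 0 < n)
  have hKn' : 768 * (K : ℝ) ^ 3 ≤ n := by exact_mod_cast hKn
  have hK' : 10 ^ 10 * (K : ℝ) ^ 9 ≤ n := by exact_mod_cast hK
  have hw' : (w : ℝ) ≤ K := by exact_mod_cast hw
  obtain ⟨j, rfl⟩ := Nat.exists_eq_add_of_le hw3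
  set w := 3 + j
  have h2 : (n : ℝ) ^ w * x ≤ 3 * (768 * (K : ℝ) ^ 3) ^ w :=
    calc (n : ℝ) ^ w * x ≤ (m.choose w * (3 * w) ^ w) * x := by gcongr
      _ ≤ (d * (3 * w) ^ w) * x := by gcongr
      _ = (d * x) * (3 * w) ^ w := by ring
      _ ≤ (3 * (16 * w : ℝ) ^ (2 * w)) * (3 * w) ^ w := by gcongr
      _ = 3 * (768 * (w : ℝ) ^ 3) ^ w := by
        rw [pow_mul, mul_assoc, ← mul_pow]
        ring_nf
      _ ≤ 3 * (768 * (K : ℝ) ^ 3) ^ w := by gcongr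
  have h3 : (n : ℝ) ^ 3 * x * n ^ j ≤ 3 * (768 * (K : ℝ) ^ 3) ^ 3 * n ^ j :=
    calc (n : ℝ) ^ 3 * x * n ^ j = n ^ w * x := by rw [pow_add]; ring
      _ ≤ 3 * (768 * (K : ℝ) ^ 3) ^ w := h2
      _ = 3 * (768 * (K : ℝ) ^ 3) ^ 3 * (768 * (K : ℝ) ^ 3) ^ j := by rw [pow_add]; ring
      _ ≤ 3 * (768 * (K : ℝ) ^ 3) ^ 3 * n ^ j := by gcongr
  have h4 := le_of_mul_le_mul_right h3 (by positivity)
  have h5 : (0 : ℝ) ≤ (K : ℝ) ^ 9 := by positivity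
  have h6 : n * ((n : ℝ) ^ 2 * x) ≤ n * 1 := by nlinarith
  exact le_of_mul_le_mul_left h6 hn0

/-- **Lemma (exactly two fixed points).** There is `N₃` such that for every `n ≥ N₃` and
every `σ ∈ S_n` with exactly two fixed points, `χ̃(σ) ≤ 1/(n-1)` for every irreducible
character `χ ∉ {triv, sgn}` (i.e., the standard representation rules for `σ`). -/
theorem std_rules_of_exactly_two_fixed_points :
    ∃ N₃ : ℕ, ∀ n : ℕ, n ≥ N₃ → ∀ σ : Equiv.Perm (Fin n), fixCount σ = 2 →
      ∀ V : FDRep ℂ (Equiv.Perm (Fin n)), IsNontrivIrr V →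
        normChar V σ ≤ 1 / ((n : ℝ) - 1) := by
  obtain ⟨N, hN⟩ := Filter.eventually_atTop.mp (eventually_mul_log_pow_le (10 ^ 10 * 34 ^ 9) 9)
  refine ⟨max N 200000, fun n hn σ hσ V ⟨_, hne, hne'⟩ ↦ ?_⟩
  have hn1 : 200000 ≤ n := (le_max_right _ _).trans hn
  have h := V.isScalarIrr
  refine (Complex.re_le_norm (V.character σ / V.character 1)).trans ?_
  obtain ⟨L, hL⟩ : ∃ L, L = Nat.log 2 n + 1 := ⟨_, rfl⟩
  have hLn : n < 2 ^ L := hL ▸ Nat.lt_pow_succ_log_self one_lt_two n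
  have hL1 : 1 ≤ L := by omega
  obtain ⟨K, hK⟩ : ∃ K, K = 2 * (11 * L + 6) := ⟨_, rfl⟩
  have hKL : K ≤ 34 * L := by omega
  have hKn : 10 ^ 10 * K ^ 9 ≤ n :=
    calc 10 ^ 10 * K ^ 9 ≤ 10 ^ 10 * (34 * L) ^ 9 :=
          Nat.mul_le_mul_left _ (Nat.pow_le_pow_left hKL 9)
      _ = 10 ^ 10 * 34 ^ 9 * (Nat.log 2 n + 1) ^ 9 := by rw [mul_pow, hL, mul_assoc]
      _ ≤ n := hN n ((le_max_left _ _).trans hn)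
  have hK2 : 32 * K ^ 2 ≤ n := by
    have : K ^ 2 ≤ K ^ 9 := Nat.pow_le_pow_right (by omega) (by norm_num)
    omega
  have hK1 : 6 * K ≤ n := by nlinarith
  by_cases hd : Module.finrank ℂ V < (n / 2).choose K
  · rcases h.norm_lam_le_or hσ (m := n / 2) (K := K) (by omega) (by omega) (by omega) (by omega)
      hK2 hd
      with h1 | ⟨v, hv, h1⟩ | ⟨v, hv, h1⟩ | ⟨w, hw3, hw, hwd, h1⟩
    · exact h1
    · exact absurd (V.character_eq_of_smul hv (h.exists_eq_smul_of_fixed hv h1) fun g ↦ by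
        rw [h1, one_smul]) hne
    · exact absurd (V.character_eq_of_smul hv (h.exists_eq_smul_of_sign hv h1) h1) hne'
    · exact le_one_div_sub_one_of_sq_le (by omega)
        (sq_mul_le_one_of_small (m := n / 2) (sq_nonneg _) (by omega) hKn hw3 hw.le
          (by exact_mod_cast hwd) h1)
  · refine le_one_div_sub_one_of_sq_le (by omega) (sq_mul_le_one_of_large hn1 (T := 11 * L) ?_ ?_
      (h.norm_lam_sq_le (by omega) hσ.le (11 * L)))
    · rw [mul_comm 11 L, pow_mul]
      exact Nat.pow_le_pow_left hLn.le 11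
    · have h1 := pow_le_choose_mul (n := n) (m := n / 2) (by omega) hK1 le_rfl
      have h2 : (3 * K) ^ K ≤ n ^ (11 * L + 6) := by
        nth_rewrite 2 [hK]
        rw [pow_mul]
        exact Nat.pow_le_pow_left (by nlinarith) _
      have h3 : n ^ (11 * L + 6) ≤ (n / 2).choose K := by
        refine le_of_mul_le_mul_right ?_ (by positivity : 0 < n ^ (11 * L + 6))
        calc n ^ (11 * L + 6) * n ^ (11 * L + 6) = n ^ K := by rw [← pow_add, hK, two_mul]
          _ ≤ _ := h1.trans (Nat.mul_le_mul_left _ h2)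
      exact_mod_cast h3.trans (not_lt.mp hd)
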